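/- Let F be a finite simple graph with |F| = 3 vertices and e(F) > 0, labelled with V(F) = {1,2,3}, let α, β > 0 with α + β < 1, and let 0 < p ≤ 1. Consider the property P̃₂(F;α,β) of sequences (G_n) with |G_n| → ∞: Ñ(F,G_n;U,U,B) = p^{e(F)}|U|²|B| + o(|G_n|³), uniformly over all disjoint subsets U, B ⊆ V(G_n) with |U| = ⌊α|G_n|⌋ and |B| = ⌊β|G_n|⌋. Then P̃₂(F;α,β) is a p-quasi-random property. -/

import Mathlib

open Filter Finset Asymptotics MeasureTheory

/-- `labCount F G U` is the number of injective graph homomorphisms `φ : F → G`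
with `φ i ∈ U i` for every vertex `i` of `F` (the quantity `N(F,G;U₁,…,U_m)`). -/
noncomputable def labCount {m : ℕ} {β : Type} [Fintype β]
    (F : SimpleGraph (Fin m)) (G : SimpleGraph β) (U : Fin m → Finset β) : ℕ :=
  Nat.card {φ : Fin m → β //
    Function.Injective φ ∧ (∀ i j, F.Adj i j → G.Adj (φ i) (φ j)) ∧ ∀ i, φ i ∈ U i}

/-- `totalCount F G` is the total number of injective graph homomorphisms `F → G`,
the quantity `N(F,G)`. -/
noncomputable def totalCount {m : ℕ} {β : Type} [Fintype β]
    (F : SimpleGraph (Fin m)) (G : SimpleGraph β) : ℕ :=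
  Nat.card {φ : Fin m → β //
    Function.Injective φ ∧ ∀ i j, F.Adj i j → G.Adj (φ i) (φ j)}

/-- `symCount F G U` is `Ñ(F,G;U₁,…,U_m) = (1/m!) ∑_σ N(F,G;U_{σ(1)},…,U_{σ(m)})`. -/
noncomputable def symCount {m : ℕ} {β : Type} [Fintype β]
    (F : SimpleGraph (Fin m)) (G : SimpleGraph β) (U : Fin m → Finset β) : ℝ :=
  ((m.factorial : ℝ))⁻¹ * ∑ σ : Equiv.Perm (Fin m), (labCount F G (fun i => U (σ i)) : ℝ)

/-- `numEdges F` is `e(F)`, the number of edges of `F`. -/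
noncomputable def numEdges {m : ℕ} (F : SimpleGraph (Fin m)) : ℕ := Nat.card F.edgeSet

/-- A sequence of graphs `G n` on vertex sets `Fin (V n)` is `p`-quasi-random if, for every
finite simple graph `F`, `N(F,G_n) = p^(e F) |G_n|^(|F|) + o(|G_n|^(|F|))`. -/
def IsQuasirandom (p : ℝ) (V : ℕ → ℕ) (G : ∀ n, SimpleGraph (Fin (V n))) : Prop :=
  ∀ (m : ℕ) (F : SimpleGraph (Fin m)),
    (fun n => (totalCount F (G n) : ℝ) - p ^ numEdges F * (V n : ℝ) ^ m)
      =o[atTop] (fun n => (V n : ℝ) ^ m)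

/-- The property `P(F;α₁,…,α_m)`: `N(F,G_n;U₁,…,U_m) = p^(e F) ∏ |U_i| + o(|G_n|^m)`,
uniformly over all pairwise disjoint `U₁,…,U_m ⊆ V(G_n)` with `|U_i| = ⌊α_i |G_n|⌋`. -/
def SatisfiesP {m : ℕ} (F : SimpleGraph (Fin m)) (p : ℝ) (α : Fin m → ℝ)
    (V : ℕ → ℕ) (G : ∀ n, SimpleGraph (Fin (V n))) : Prop :=
  ∃ ε : ℕ → ℝ, Tendsto ε atTop (nhds 0) ∧
    ∀ (n : ℕ) (U : Fin m → Finset (Fin (V n))),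
      Pairwise (fun i j => Disjoint (U i) (U j)) →
      (∀ i, (U i).card = ⌊α i * (V n : ℝ)⌋₊) →
      |(labCount F (G n) U : ℝ) - p ^ numEdges F * ∏ i, ((U i).card : ℝ)|
        ≤ ε n * (V n : ℝ) ^ m

/-- The property `P̃(F;α₁,…,α_m)`: as `SatisfiesP` but with the symmetrized count `Ñ`. -/
def SatisfiesPt {m : ℕ} (F : SimpleGraph (Fin m)) (p : ℝ) (α : Fin m → ℝ)
    (V : ℕ → ℕ) (G : ∀ n, SimpleGraph (Fin (V n))) : Prop :=
  ∃ ε : ℕ → ℝ, Tendsto ε atTop (nhds 0) ∧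
    ∀ (n : ℕ) (U : Fin m → Finset (Fin (V n))),
      Pairwise (fun i j => Disjoint (U i) (U j)) →
      (∀ i, (U i).card = ⌊α i * (V n : ℝ)⌋₊) →
      |symCount F (G n) U - p ^ numEdges F * ∏ i, ((U i).card : ℝ)|
        ≤ ε n * (V n : ℝ) ^ m

/-- The property `Pᵘ(F;α₁,…,α_m)`: `P` holds for every labelling of `F`. -/
def SatisfiesPu {m : ℕ} (F : SimpleGraph (Fin m)) (p : ℝ) (α : Fin m → ℝ)
    (V : ℕ → ℕ) (G : ∀ n, SimpleGraph (Fin (V n))) : Prop :=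
  ∀ σ : Equiv.Perm (Fin m), SatisfiesP (SimpleGraph.map σ.toEmbedding F) p α V G

open scoped BigOperators

section WeakForms

variable {V : Type} [Fintype V]

/-- The kernel `g` has small integral against all products of bounded functions. -/
def WeakSmall₂ (δ : ℝ) (g : V → V → ℝ) : Prop :=
  ∀ u v : V → ℝ, (∀ x, |u x| ≤ 1) → (∀ x, |v x| ≤ 1) →
    |𝔼 x, 𝔼 y, g x y * u x * v y| ≤ δ

/-- The ternary kernel `f` has small integral against all products of bounded functions. -/
def WeakSmall₃ (δ : ℝ) (f : V → V → V → ℝ) : Prop :=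
  ∀ u v w : V → ℝ, (∀ x, |u x| ≤ 1) → (∀ x, |v x| ≤ 1) → (∀ x, |w x| ≤ 1) →
    |𝔼 x, 𝔼 y, 𝔼 z, f x y z * u x * v y * w z| ≤ δ

lemma abs_expect_le_of_forall [Nonempty V] {f : V → ℝ} {c : ℝ} (h : ∀ x, |f x| ≤ c) :
    |𝔼 x, f x| ≤ c :=
  (abs_expect_le _ _).trans (expect_le univ_nonempty fun x _ => h x)

lemma expect_mono {f g : V → ℝ} (h : ∀ x, f x ≤ g x) : 𝔼 x, f x ≤ 𝔼 x, g x :=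
  expect_le_expect fun x _ => h x

lemma expect_nonneg_of_forall {f : V → ℝ} (h : ∀ x, 0 ≤ f x) : 0 ≤ 𝔼 x, f x :=
  expect_nonneg fun x _ => h x

lemma abs_mul_le_one {a b : ℝ} (ha : |a| ≤ 1) (hb : |b| ≤ 1) : |a * b| ≤ 1 := by
  rw [abs_mul]; exact mul_le_one₀ ha (abs_nonneg _) hb

lemma sq_expect_le [Nonempty V] (f : V → ℝ) : (𝔼 x, f x) ^ 2 ≤ 𝔼 x, f x ^ 2 := by
  have := expect_mul_sq_le_sq_mul_sq univ f (fun _ => (1 : ℝ))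
  simpa using this

lemma sq_expect₂_le [Nonempty V] (g : V → V → ℝ) :
    (𝔼 x, 𝔼 y, g x y) ^ 2 ≤ 𝔼 x, 𝔼 y, g x y ^ 2 :=
  (sq_expect_le _).trans (expect_mono fun _ => sq_expect_le _)

lemma expect_le_sqrt [Nonempty V] {f : V → ℝ} {c : ℝ} (h : 𝔼 x, f x ^ 2 ≤ c) :
    𝔼 x, |f x| ≤ √c := by
  apply Real.le_sqrt_of_sq_le
  refine (sq_expect_le _).trans ?_
  simpa using h

lemma expect₂_le_sqrt [Nonempty V] {g : V → V → ℝ} {c : ℝ} (h : 𝔼 x, 𝔼 y, g x y ^ 2 ≤ c) :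
    𝔼 x, 𝔼 y, |g x y| ≤ √c := by
  apply Real.le_sqrt_of_sq_le
  refine (sq_expect₂_le _).trans ?_
  simpa using h

lemma WeakSmall₂.mono {δ δ' : ℝ} {g : V → V → ℝ} (h : WeakSmall₂ δ g) (hδ : δ ≤ δ') :
    WeakSmall₂ δ' g := fun u v hu hv => (h u v hu hv).trans hδ

lemma WeakSmall₂.of_expect_abs_le {δ : ℝ} {g : V → V → ℝ} (h : 𝔼 x, 𝔼 y, |g x y| ≤ δ) :
    WeakSmall₂ δ g := by
  intro u v hu hv
  refine (abs_expect_le _ _).trans (le_trans (expect_mono fun x => ?_) h)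
  refine (abs_expect_le _ _).trans (expect_mono fun y => ?_)
  rw [mul_assoc, abs_mul]
  exact mul_le_of_le_one_right (abs_nonneg _) (abs_mul_le_one (hu x) (hv y))

lemma WeakSmall₂.add {δ ε : ℝ} {g h : V → V → ℝ} (hg : WeakSmall₂ δ g) (hh : WeakSmall₂ ε h) :
    WeakSmall₂ (δ + ε) (fun x y => g x y + h x y) := by
  intro u v hu hv
  have : 𝔼 x, 𝔼 y, (g x y + h x y) * u x * v y
      = (𝔼 x, 𝔼 y, g x y * u x * v y) + 𝔼 x, 𝔼 y, h x y * u x * v y := by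
    simp only [add_mul, expect_add_distrib]
  rw [this]
  exact (abs_add_le _ _).trans (add_le_add (hg u v hu hv) (hh u v hu hv))

lemma WeakSmall₂.const_mul {δ : ℝ} {g : V → V → ℝ} (c : ℝ) (hg : WeakSmall₂ δ g) :
    WeakSmall₂ (|c| * δ) (fun x y => c * g x y) := by
  intro u v hu hv
  have : 𝔼 x, 𝔼 y, c * g x y * u x * v y = c * 𝔼 x, 𝔼 y, g x y * u x * v y := by
    simp only [mul_expect, mul_assoc]
  rw [this, abs_mul]
  exact mul_le_mul_of_nonneg_left (hg u v hu hv) (abs_nonneg _)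

lemma WeakSmall₂.sub {δ ε : ℝ} {g h : V → V → ℝ} (hg : WeakSmall₂ δ g) (hh : WeakSmall₂ ε h) :
    WeakSmall₂ (δ + ε) (fun x y => g x y - h x y) := by
  have := hg.add (hh.const_mul (-1))
  simpa [sub_eq_add_neg] using this

lemma WeakSmall₂.congr {δ : ℝ} {g h : V → V → ℝ} (hg : WeakSmall₂ δ g)
    (e : ∀ x y, g x y = h x y) : WeakSmall₂ δ h := by
  obtain rfl : g = h := by ext x y; exact e x y
  exact hg

lemma WeakSmall₂.mul_expect_mul [Nonempty V] {δ : ℝ} {g : V → V → ℝ} (hg : WeakSmall₂ δ g)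
    {a b : V → V → ℝ} (ha : ∀ w x, |a w x| ≤ 1) (hb : ∀ w x, |b w x| ≤ 1) :
    WeakSmall₂ δ (fun x y => g x y * 𝔼 w, a w x * b w y) := by
  intro u v hu hv
  have : 𝔼 x, 𝔼 y, (g x y * 𝔼 w, a w x * b w y) * u x * v y
      = 𝔼 w, 𝔼 x, 𝔼 y, g x y * (u x * a w x) * (v y * b w y) := by
    refine Eq.trans (expect_congr rfl fun x _ => ?_) (expect_comm _ _ _)
    refine Eq.trans (expect_congr rfl fun y _ => ?_) (expect_comm _ _ _)
    rw [mul_expect, expect_mul, expect_mul]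
    exact expect_congr rfl fun w _ => by ring
  rw [this]
  exact abs_expect_le_of_forall fun w =>
    hg _ _ (fun x => abs_mul_le_one (hu x) (ha w x)) (fun y => abs_mul_le_one (hv y) (hb w y))

lemma WeakSmall₂.expect_abs_left_le {δ : ℝ} {g : V → V → ℝ} (hg : WeakSmall₂ δ g)
    [Nonempty V] : 𝔼 x, |𝔼 y, g x y| ≤ δ := by
  have := hg (fun x => SignType.sign (𝔼 y, g x y)) (fun _ => 1) (fun x => ?_) (by simp)
  · refine le_trans (le_of_eq ?_) ((le_abs_self _).trans this)
    refine expect_congr rfl fun x _ => ?_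
    simp only [mul_one, ← expect_mul]
    exact (self_mul_sign _).symm
  · rcases lt_trichotomy (𝔼 y, g x y) 0 with h | h | h <;> simp [h]

end WeakForms

/-- A kernel that is symmetric with values in `[0, 1]`, such as an adjacency matrix. -/
structure IsUnitKernel {V : Type} (A : V → V → ℝ) : Prop where
  symm : ∀ x y, A x y = A y x
  nonneg : ∀ x y, 0 ≤ A x y
  le_one : ∀ x y, A x y ≤ 1

lemma IsUnitKernel.abs_le_one {V : Type} {A : V → V → ℝ} (hA : IsUnitKernel A) (x y : V) :
    |A x y| ≤ 1 := by
  rw [abs_of_nonneg (hA.nonneg x y)]; exact hA.le_one x y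

section Kernels

variable {V : Type} [Fintype V] {A : V → V → ℝ}

/-- The normalized degree. -/
noncomputable def ndeg (A : V → V → ℝ) (x : V) : ℝ := 𝔼 y, A x y

/-- The normalized codegree. -/
noncomputable def ncodeg (A : V → V → ℝ) (x y : V) : ℝ := 𝔼 z, A x z * A y z

lemma IsUnitKernel.ndeg_nonneg (hA : IsUnitKernel A) (x : V) : 0 ≤ ndeg A x :=
  expect_nonneg_of_forall fun y => hA.nonneg x y

lemma IsUnitKernel.ndeg_le_one [Nonempty V] (hA : IsUnitKernel A) (x : V) : ndeg A x ≤ 1 :=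
  expect_le univ_nonempty fun y _ => hA.le_one x y

lemma IsUnitKernel.abs_ndeg_le_one [Nonempty V] (hA : IsUnitKernel A) (x : V) : |ndeg A x| ≤ 1 := by
  rw [abs_of_nonneg (hA.ndeg_nonneg x)]; exact hA.ndeg_le_one x

lemma IsUnitKernel.ncodeg_nonneg (hA : IsUnitKernel A) (x y : V) : 0 ≤ ncodeg A x y :=
  expect_nonneg_of_forall fun z => mul_nonneg (hA.nonneg x z) (hA.nonneg y z)

lemma IsUnitKernel.weakSmall₂_mul_ncodeg [Nonempty V] (hA : IsUnitKernel A) {δ : ℝ} {g : V → V → ℝ}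
    (hg : WeakSmall₂ δ g) : WeakSmall₂ δ (fun x y => g x y * ncodeg A x y) := by
  have := hg.mul_expect_mul (a := fun w x => A x w) (b := fun w x => A x w)
    (fun w x => hA.abs_le_one x w) (fun w x => hA.abs_le_one x w)
  exact this

lemma expect_ncodeg (hA : IsUnitKernel A) (x : V) :
    𝔼 y, ncodeg A x y = 𝔼 y, A x y * ndeg A y := by
  unfold ncodeg ndeg
  rw [expect_comm]
  refine expect_congr rfl fun z _ => ?_
  rw [mul_expect]
  exact expect_congr rfl fun y _ => by rw [hA.symm y z]

/-- If the symmetrized density of a single edge is weakly constant, the kernel is weakly constant. -/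
lemma weakSmall₂_of_edge [Nonempty V] {p δ : ℝ}
    (h : WeakSmall₃ δ fun x y z => (A x y + A y z + A x z) / 3 - p) :
    WeakSmall₂ (7 * δ) fun x y => A x y - p := by
  set S : (V → ℝ) → (V → ℝ) → ℝ := fun u v => 𝔼 x, 𝔼 y, (A x y - p) * u x * v y with hS
  have key : ∀ u v w : V → ℝ, 𝔼 x, 𝔼 y, 𝔼 z, ((A x y + A y z + A x z) / 3 - p) * u x * v y * w z
      = (1 / 3) * (S u v * (𝔼 z, w z) + (𝔼 x, u x) * S v w + S u w * 𝔼 y, v y) := by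
    intro u v w
    have e1 : S u v * (𝔼 z, w z) = 𝔼 x, 𝔼 y, 𝔼 z, (A x y - p) * u x * v y * w z := by
      simp only [hS, expect_mul]; simp only [mul_expect]
    have e2 : (𝔼 x, u x) * S v w = 𝔼 x, 𝔼 y, 𝔼 z, u x * ((A y z - p) * v y * w z) := by
      simp only [hS, expect_mul]; simp only [mul_expect]
    have e3 : S u w * (𝔼 y, v y) = 𝔼 x, 𝔼 y, 𝔼 z, (A x z - p) * u x * w z * v y := by
      simp only [hS, expect_mul]; simp only [mul_expect]
      exact expect_congr rfl fun x _ => expect_comm _ _ _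
    rw [e1, e2, e3]
    simp only [← expect_add_distrib, mul_expect]
    exact expect_congr rfl fun x _ => expect_congr rfl fun y _ => expect_congr rfl fun z _ => by ring
  have one : ∀ x : V, |(fun _ : V => (1 : ℝ)) x| ≤ 1 := by simp
  have m1 : 𝔼 _x : V, (1 : ℝ) = 1 := Fintype.expect_const _
  have h11 : |S (fun _ => 1) (fun _ => 1)| ≤ δ := by
    have := h _ _ _ one one one
    rw [key, m1] at this
    convert this using 2; ring
  have h1 : ∀ u : V → ℝ, (∀ x, |u x| ≤ 1) → |S u (fun _ => 1)| ≤ 2 * δ := by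
    intro u hu
    have := h _ _ _ hu one one
    rw [key, m1] at this
    have hm : |𝔼 x, u x| ≤ 1 := abs_expect_le_of_forall hu
    have h2 : |(𝔼 x, u x) * S (fun _ => 1) (fun _ => 1)| ≤ δ := by
      rw [abs_mul]
      exact (mul_le_of_le_one_left (abs_nonneg _) hm).trans h11
    rw [abs_le] at this h2 ⊢
    constructor <;> linarith
  intro u v hu hv
  have := h _ _ _ hu hv one
  rw [key, m1] at this
  have h2 : |(𝔼 x, u x) * S v (fun _ => 1)| ≤ 2 * δ := by
    rw [abs_mul]
    exact (mul_le_of_le_one_left (abs_nonneg _) (abs_expect_le_of_forall hu)).trans (h1 v hv)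
  have h3 : |S u (fun _ => 1) * 𝔼 x, v x| ≤ 2 * δ := by
    rw [abs_mul]
    exact (mul_le_of_le_one_right (abs_nonneg _) (abs_expect_le_of_forall hv)).trans (h1 u hu)
  change |S u v| ≤ _
  rw [abs_le] at this h2 h3 ⊢
  constructor <;> linarith

end Kernels

section Cherry

variable {V : Type} [Fintype V] [Nonempty V] {A : V → V → ℝ} {p δ : ℝ}

lemma weakSmall₂_of_cherry
    (h : WeakSmall₃ δ fun x y z =>
      (A x y * A y z + A y z * A x z + A x y * A x z) / 3 - p ^ 2) :
    WeakSmall₂ (3 * δ)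
      fun x y => A x y * (ndeg A x + ndeg A y) + ncodeg A x y - 3 * p ^ 2 := by
  intro u v hu hv
  have key : 𝔼 x, 𝔼 y, (A x y * (ndeg A x + ndeg A y) + ncodeg A x y - 3 * p ^ 2) * u x * v y
      = 3 * 𝔼 x, 𝔼 y, 𝔼 z, ((A x y * A y z + A y z * A x z + A x y * A x z) / 3 - p ^ 2)
          * u x * v y * 1 := by
    simp only [mul_expect (a := (3 : ℝ))]
    refine expect_congr rfl fun x _ => expect_congr rfl fun y _ => ?_
    have : ∀ z, 3 * (((A x y * A y z + A y z * A x z + A x y * A x z) / 3 - p ^ 2)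
        * u x * v y * 1) = (A x y * u x * v y) * A y z + (u x * v y) * (A x z * A y z)
        + (A x y * u x * v y) * A x z - 3 * p ^ 2 * u x * v y := fun z => by ring
    simp only [this, expect_add_distrib, expect_sub_distrib, ← mul_expect, Fintype.expect_const,
      ndeg, ncodeg]
    ring
  rw [key, abs_mul, abs_of_pos (by norm_num : (0 : ℝ) < 3)]
  have := h u v (fun _ => 1) hu hv (by simp)
  linarith

lemma IsUnitKernel.expect_abs_ndeg_residual_le (hA : IsUnitKernel A)
    (h : WeakSmall₂ δ
      fun x y => A x y * (ndeg A x + ndeg A y) + ncodeg A x y - 3 * p ^ 2) :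
    𝔼 x, |ndeg A x ^ 2 + 2 * (𝔼 y, A x y * ndeg A y) - 3 * p ^ 2| ≤ δ := by
  refine le_trans (le_of_eq (expect_congr rfl fun x _ => ?_)) h.expect_abs_left_le
  congr 1
  have : ∀ y, A x y * (ndeg A x + ndeg A y) + ncodeg A x y - 3 * p ^ 2
      = ndeg A x * A x y + A x y * ndeg A y + ncodeg A x y - 3 * p ^ 2 := fun y => by ring
  simp only [this, expect_add_distrib, expect_sub_distrib, ← mul_expect, Fintype.expect_const,
    expect_ncodeg hA]
  rw [show 𝔼 y, A x y = ndeg A x from rfl]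
  ring

/-- Approximate regularity from the equation `d² + 2 A d = 3 p²` for the degree function `d`. -/
lemma IsUnitKernel.expect_abs_ndeg_sub_le (hA : IsUnitKernel A) (hp0 : 0 < p) (hp1 : p ≤ 1)
    {η : ℝ} (hη0 : 0 < η) (hη1 : η < 1)
    (h : 𝔼 x, |ndeg A x ^ 2 + 2 * (𝔼 y, A x y * ndeg A y) - 3 * p ^ 2| ≤ η ^ 2) :
    𝔼 x, |ndeg A x - p| ≤ 8 * η / p := by
  classical
  set d := ndeg A with hd
  set r : V → ℝ := fun x => d x ^ 2 + 2 * (𝔼 y, A x y * d y) - 3 * p ^ 2 with hr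
  have hd0 : ∀ x, 0 ≤ d x := hA.ndeg_nonneg
  have hd1 : ∀ x, d x ≤ 1 := hA.ndeg_le_one
  have hrη : 𝔼 x, |r x| / η ≤ η := by
    rw [← expect_div, div_le_iff₀ hη0]
    calc _ ≤ η ^ 2 := h
      _ = η * η := by ring
  have hrη0 : ∀ x, 0 ≤ |r x| / η := fun x => by positivity
  set S : Finset V := univ.filter fun x => |r x| ≤ η with hS
  have hbad : ∀ x, x ∉ S → 1 ≤ |r x| / η := by
    intro x hx
    rw [le_div_iff₀ hη0, one_mul]
    by_contra hc
    exact hx (by simp [hS, (not_le.mp hc).le])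
  have hSne : S.Nonempty := by
    by_contra hc
    rw [not_nonempty_iff_eq_empty] at hc
    have : (1 : ℝ) ≤ 𝔼 x, |r x| / η :=
      le_expect univ_nonempty fun x _ => hbad x (by simp [hc])
    linarith
  obtain ⟨a, haS, ha⟩ := S.exists_max_image d hSne
  obtain ⟨b, hbS, hb⟩ := S.exists_min_image d hSne
  have hra : |r a| ≤ η := by simpa [hS] using haS
  have hrb : |r b| ≤ η := by simpa [hS] using hbS
  have lower : d b * d a - η ≤ 𝔼 y, A a y * d y := by
    have : 𝔼 y, (d b * A a y - |r y| / η) ≤ 𝔼 y, A a y * d y := by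
      refine expect_mono fun y => ?_
      by_cases hy : y ∈ S
      · have := mul_le_mul_of_nonneg_left (hb y hy) (hA.nonneg a y)
        linarith [hrη0 y]
      · have h1 := hbad y hy
        have h2 : d b * A a y ≤ 1 := mul_le_one₀ (hd1 b) (hA.nonneg a y) (hA.le_one a y)
        have h3 := mul_nonneg (hA.nonneg a y) (hd0 y)
        linarith
    rw [expect_sub_distrib, ← mul_expect] at this
    have e : 𝔼 y, A a y = d a := rfl
    rw [e] at this
    linarith
  have upper : 𝔼 y, A b y * d y ≤ d a * d b + η := by
    have : 𝔼 y, A b y * d y ≤ 𝔼 y, (d a * A b y + |r y| / η) := by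
      refine expect_mono fun y => ?_
      by_cases hy : y ∈ S
      · have := mul_le_mul_of_nonneg_left (ha y hy) (hA.nonneg b y)
        linarith [hrη0 y]
      · have h1 := hbad y hy
        have h2 : A b y * d y ≤ 1 := mul_le_one₀ (hA.le_one b y) (hd0 y) (hd1 y)
        have h3 := mul_nonneg (hd0 a) (hA.nonneg b y)
        linarith
    rw [expect_add_distrib, ← mul_expect] at this
    have e : 𝔼 y, A b y = d b := rfl
    rw [e] at this
    linarith
  have hab : d b ≤ d a := ha b hbS
  rw [abs_le] at hra hrb
  simp only [hr] at hra hrb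
  have h1 : d a ^ 2 + 2 * (d b * d a) ≤ 3 * p ^ 2 + 3 * η := by linarith [hra.2]
  have h2 : 3 * p ^ 2 - 3 * η ≤ d b ^ 2 + 2 * (d b * d a) := by linarith [hrb.1]
  have h3 : d b ^ 2 ≤ d b * d a := by nlinarith [hd0 b]
  have h4 : d b * d a ≤ d a ^ 2 := by nlinarith [hd0 a]
  have good : ∀ x ∈ S, |d x - p| ≤ 7 * η / p := by
    intro x hx
    have hxa : d x ^ 2 ≤ d a ^ 2 := pow_le_pow_left₀ (hd0 x) (ha x hx) 2
    have hxb : d b ^ 2 ≤ d x ^ 2 := pow_le_pow_left₀ (hd0 b) (hb x hx) 2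
    have h5 : |d x ^ 2 - p ^ 2| ≤ 7 * η := by rw [abs_le]; constructor <;> linarith
    have h6 : d x ^ 2 - p ^ 2 = (d x - p) * (d x + p) := by ring
    rw [h6, abs_mul, abs_of_nonneg (by linarith [hd0 x] : 0 ≤ d x + p)] at h5
    rw [le_div_iff₀ hp0]
    exact (mul_le_mul_of_nonneg_left (by linarith [hd0 x]) (abs_nonneg _)).trans h5
  calc 𝔼 x, |d x - p| ≤ 𝔼 x, (7 * η / p + |r x| / η) := by
        refine expect_mono fun x => ?_
        by_cases hx : x ∈ S
        · linarith [good x hx, hrη0 x]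
        · have h7 := hbad x hx
          have h8 : |d x - p| ≤ 1 := by
            rw [abs_le]; constructor <;> linarith [hd0 x, hd1 x]
          have h9 : 0 ≤ 7 * η / p := by positivity
          linarith
    _ ≤ 7 * η / p + η := by
        rw [expect_add_distrib, Fintype.expect_const]; linarith
    _ ≤ 8 * η / p := by
        have : η ≤ η / p := by rw [le_div_iff₀ hp0]; nlinarith
        have e : 8 * η / p = 7 * η / p + η / p := by ring
        linarith

/-- An approximately regular kernel with `2 p A + A² ≈ 3 p²` is weakly constant. -/
lemma IsUnitKernel.weakSmall₂_of_ncodeg_add (hA : IsUnitKernel A) (hp0 : 0 < p) (hp1 : p ≤ 1)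
    {δ τ : ℝ}
    (h : WeakSmall₂ δ
      fun x y => A x y * (ndeg A x + ndeg A y) + ncodeg A x y - 3 * p ^ 2)
    (hτ : 𝔼 x, |ndeg A x - p| ≤ τ) :
    WeakSmall₂ (√((δ + 4 * τ) / p)) fun x y => A x y - p := by
  set d := ndeg A with hd
  have hd0 : ∀ x, 0 ≤ d x := hA.ndeg_nonneg
  have h2p : WeakSmall₂ (δ + 2 * τ) fun x y => 2 * p * A x y + ncodeg A x y - 3 * p ^ 2 := by
    have : WeakSmall₂ (2 * τ) fun x y => A x y * (d x + d y - 2 * p) := by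
      apply WeakSmall₂.of_expect_abs_le
      calc 𝔼 x, 𝔼 y, |A x y * (d x + d y - 2 * p)|
          ≤ 𝔼 x, 𝔼 y, (|d x - p| + |d y - p|) := by
            refine expect_mono fun x => expect_mono fun y => ?_
            rw [abs_mul]
            refine (mul_le_of_le_one_left (abs_nonneg _) (hA.abs_le_one x y)).trans ?_
            rw [show d x + d y - 2 * p = (d x - p) + (d y - p) by ring]
            exact abs_add_le _ _
        _ ≤ 2 * τ := by
            simp only [expect_add_distrib, Fintype.expect_const]; linarith
    exact (h.sub this).congr fun x y => by ring
  intro u v hu hv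
  set f : V → ℝ := fun x => 𝔼 y, (A x y - p) * v y with hf
  have hf1 : ∀ x, |f x| ≤ 1 := fun x => abs_expect_le_of_forall fun y =>
    abs_mul_le_one (by rw [abs_le]; constructor <;> linarith [hA.nonneg x y, hA.le_one x y]) (hv y)
  have hAf : 𝔼 x, 𝔼 y, A x y * f x * f y
      = (𝔼 x, 𝔼 y, (2 * p * A x y + ncodeg A x y - 3 * p ^ 2) * f x * v y)
        - p * (𝔼 x, (d x - p) * f x) * (𝔼 y, v y) - 2 * p * 𝔼 x, f x ^ 2 := by
    have e1 : 𝔼 x, 𝔼 y, A x y * f x * f y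
        = 𝔼 x, 𝔼 z, (ncodeg A x z - p * d x) * f x * v z := by
      refine expect_congr rfl fun x _ => ?_
      rw [expect_congr rfl fun y _ => (mul_expect _ _ _ :
        A x y * f x * f y = 𝔼 z, A x y * f x * ((A y z - p) * v z)), expect_comm]
      refine expect_congr rfl fun z _ => ?_
      have : ∀ y, A x y * f x * ((A y z - p) * v z)
          = (f x * v z) * (A x y * A z y) - (p * f x * v z) * A x y := fun y => by
        rw [hA.symm y z]; ring
      simp only [this, expect_sub_distrib, ← mul_expect]
      simp only [hd, ndeg, ncodeg]
      ring
    have e2 : p * (𝔼 x, (d x - p) * f x) * (𝔼 y, v y)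
        = 𝔼 x, 𝔼 y, p * ((d x - p) * f x) * v y := by
      rw [mul_expect (a := p), expect_mul]; simp only [mul_expect]
    have e3 : 2 * p * 𝔼 x, f x ^ 2 = 𝔼 x, 𝔼 y, 2 * p * ((A x y - p) * v y * f x) := by
      rw [mul_expect]
      refine expect_congr rfl fun x _ => ?_
      rw [← mul_expect, ← expect_mul, sq]
    rw [e1, e2, e3]
    simp only [← expect_sub_distrib]
    exact expect_congr rfl fun x _ => expect_congr rfl fun y _ => by ring
  have hpos : -(𝔼 x, d x * f x ^ 2) ≤ 𝔼 x, 𝔼 y, A x y * f x * f y := by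
    have e : (𝔼 x, d x * f x ^ 2) + (𝔼 x, d x * f x ^ 2) + 2 * 𝔼 x, 𝔼 y, A x y * f x * f y
        = 𝔼 x, 𝔼 y, A x y * (f x + f y) ^ 2 := by
      have e1 : 𝔼 x, d x * f x ^ 2 = 𝔼 x, 𝔼 y, A x y * f x ^ 2 := by
        simp only [hd, ndeg, expect_mul]
      have e2 : 𝔼 x, d x * f x ^ 2 = 𝔼 x, 𝔼 y, A x y * f y ^ 2 := by
        rw [e1, expect_comm]
        exact expect_congr rfl fun x _ => expect_congr rfl fun y _ => by rw [hA.symm]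
      nth_rw 1 [e1]
      rw [e2, mul_expect]
      simp only [mul_expect (a := (2 : ℝ)), ← expect_add_distrib]
      exact expect_congr rfl fun x _ => expect_congr rfl fun y _ => by ring
    have : 0 ≤ 𝔼 x, 𝔼 y, A x y * (f x + f y) ^ 2 :=
      expect_nonneg_of_forall fun x => expect_nonneg_of_forall fun y =>
        mul_nonneg (hA.nonneg x y) (sq_nonneg _)
    linarith
  have hdf : 𝔼 x, d x * f x ^ 2 ≤ p * (𝔼 x, f x ^ 2) + τ := by
    have : 𝔼 x, d x * f x ^ 2 ≤ 𝔼 x, (p * f x ^ 2 + |d x - p|) := by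
      refine expect_mono fun x => ?_
      have h1 : f x ^ 2 ≤ 1 := by rw [← sq_abs]; exact pow_le_one₀ (abs_nonneg _) (hf1 x)
      have h2 : (d x - p) * f x ^ 2 ≤ |d x - p| :=
        (mul_le_mul_of_nonneg_right (le_abs_self _) (sq_nonneg _)).trans
          (mul_le_of_le_one_right (abs_nonneg _) h1)
      linarith
    rw [expect_add_distrib, ← mul_expect] at this
    linarith
  have hd' : |p * (𝔼 x, (d x - p) * f x) * (𝔼 y, v y)| ≤ τ := by
    rw [abs_mul, abs_mul, abs_of_pos hp0]
    have h1 : |𝔼 x, (d x - p) * f x| ≤ τ := by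
      refine (abs_expect_le _ _).trans (le_trans (expect_mono fun x => ?_) hτ)
      rw [abs_mul]
      exact mul_le_of_le_one_right (abs_nonneg _) (hf1 x)
    have h2 := abs_expect_le_of_forall hv
    calc p * |𝔼 x, (d x - p) * f x| * |𝔼 y, v y| ≤ 1 * |𝔼 x, (d x - p) * f x| * 1 := by gcongr
      _ ≤ τ := by linarith
  have hmain : 𝔼 x, f x ^ 2 ≤ (δ + 4 * τ) / p := by
    rw [le_div_iff₀ hp0]
    have := h2p f v hf1 hv
    rw [abs_le] at this hd'
    linarith [this.2, hd'.1]
  have : 𝔼 x, 𝔼 y, (A x y - p) * u x * v y = 𝔼 x, u x * f x := by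
    refine expect_congr rfl fun x _ => ?_
    rw [hf, mul_expect]
    exact expect_congr rfl fun y _ => by ring
  rw [this]
  refine (abs_expect_le _ _).trans (le_trans (expect_mono fun x => ?_) (expect_le_sqrt hmain))
  rw [abs_mul]
  exact mul_le_of_le_one_left (abs_nonneg _) (hu x)

/-- If the symmetrized density of a path with two edges is weakly constant, then the kernel is
weakly constant. -/
lemma exists_weakSmall₂_of_cherry (hp0 : 0 < p) (hp1 : p ≤ 1) {ε : ℝ} (hε : 0 < ε) :
    ∃ δ > 0, ∀ (V : Type) [Fintype V] [Nonempty V] (A : V → V → ℝ), IsUnitKernel A →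
      (WeakSmall₃ δ fun x y z =>
        (A x y * A y z + A y z * A x z + A x y * A x z) / 3 - p ^ 2) →
      WeakSmall₂ ε fun x y => A x y - p := by
  have hc : Tendsto (fun η : ℝ => √((η ^ 2 + 4 * (8 * η / p)) / p)) (nhdsWithin 0 (Set.Ioi 0))
      (nhds 0) := by
    have : Continuous fun η : ℝ => √((η ^ 2 + 4 * (8 * η / p)) / p) := by fun_prop
    have := this.tendsto 0
    simp only [ne_eq, OfNat.ofNat_ne_zero, not_false_eq_true, zero_pow, mul_zero, zero_div,
      add_zero, Real.sqrt_zero] at this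
    exact this.mono_left nhdsWithin_le_nhds
  obtain ⟨η, hη, hη1, hη0⟩ := ((hc.eventually (ge_mem_nhds hε)).and
    ((eventually_nhdsWithin_of_eventually_nhds (gt_mem_nhds (zero_lt_one' ℝ))).and
      eventually_mem_nhdsWithin)).exists
  have hη0 : 0 < η := hη0
  refine ⟨η ^ 2 / 3, by positivity, fun V _ _ A hA h => ?_⟩
  have h1 := weakSmall₂_of_cherry h
  rw [show 3 * (η ^ 2 / 3) = η ^ 2 by ring] at h1
  have h2 := hA.expect_abs_ndeg_sub_le hp0 hp1 hη0 hη1 (hA.expect_abs_ndeg_residual_le h1)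
  exact (hA.weakSmall₂_of_ncodeg_add hp0 hp1 h1 h2).mono hη

end Cherry

lemma expect_rotate₃ {V : Type} [Fintype V] (f : V → V → V → ℝ) :
    𝔼 z, 𝔼 x, 𝔼 y, f x y z = 𝔼 x, 𝔼 y, 𝔼 z, f x y z := by
  rw [expect_comm]
  exact expect_congr rfl fun x _ => expect_comm _ _ _

section Triangle

variable {V : Type} [Fintype V] [Nonempty V] {A : V → V → ℝ} {p δ : ℝ}

/-- Counting copies of `K₄` by removing one of two triangles that share an edge. -/
lemma IsUnitKernel.abs_expect_star_sub_star_le (hA : IsUnitKernel A) (hp0 : 0 < p)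
    (h : WeakSmall₃ δ fun x y z => A x y * A y z * A x z - p ^ 3)
    {t s u v : V → ℝ} (ht : ∀ x, |t x| ≤ 1) (hs : ∀ x, |s x| ≤ 1) (hu : ∀ x, |u x| ≤ 1)
    (hv : ∀ x, |v x| ≤ 1) :
    |𝔼 z, 𝔼 w, 𝔼 x, 𝔼 y, A z w * (A x w * A y w - A x z * A y z) * t x * s y * u z * v w|
      ≤ 2 * δ / p ^ 3 := by
  set K : V → V → V → V → ℝ := fun z w x y => (A x y * A z w) * (A x z * A x w) * (A y z * A y w)
    * t x * s y * u z * v w with hK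
  have h1 : |𝔼 z, 𝔼 w, 𝔼 x, 𝔼 y,
      (K z w x y - p ^ 3 * (A z w * (A x w * A y w) * t x * s y * u z * v w))| ≤ δ := by
    have e : 𝔼 z, 𝔼 w, 𝔼 x, 𝔼 y,
        (K z w x y - p ^ 3 * (A z w * (A x w * A y w) * t x * s y * u z * v w))
        = 𝔼 w, v w * 𝔼 x, 𝔼 y, 𝔼 z, (A x y * A y z * A x z - p ^ 3)
          * (t x * A x w) * (s y * A y w) * (u z * A z w) := by
      rw [expect_comm]
      refine expect_congr rfl fun w _ => ?_
      rw [expect_rotate₃ fun x y z =>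
        K z w x y - p ^ 3 * (A z w * (A x w * A y w) * t x * s y * u z * v w)]
      simp only [mul_expect]
      exact expect_congr rfl fun x _ => expect_congr rfl fun y _ => expect_congr rfl fun z _ => by
        simp only [hK]; ring
    rw [e]
    refine abs_expect_le_of_forall fun w => ?_
    rw [abs_mul]
    exact (mul_le_of_le_one_left (abs_nonneg _) (hv w)).trans
      (h _ _ _ (fun x => abs_mul_le_one (ht x) (hA.abs_le_one x w))
        (fun x => abs_mul_le_one (hs x) (hA.abs_le_one x w))
        (fun x => abs_mul_le_one (hu x) (hA.abs_le_one x w)))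
  have h2 : |𝔼 z, 𝔼 w, 𝔼 x, 𝔼 y,
      (K z w x y - p ^ 3 * (A z w * (A x z * A y z) * t x * s y * u z * v w))| ≤ δ := by
    have e : 𝔼 z, 𝔼 w, 𝔼 x, 𝔼 y,
        (K z w x y - p ^ 3 * (A z w * (A x z * A y z) * t x * s y * u z * v w))
        = 𝔼 z, u z * 𝔼 x, 𝔼 y, 𝔼 w, (A x y * A y w * A x w - p ^ 3)
          * (t x * A x z) * (s y * A y z) * (v w * A z w) := by
      refine expect_congr rfl fun z _ => ?_
      rw [expect_rotate₃ fun x y w =>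
        K z w x y - p ^ 3 * (A z w * (A x z * A y z) * t x * s y * u z * v w)]
      simp only [mul_expect]
      exact expect_congr rfl fun x _ => expect_congr rfl fun y _ => expect_congr rfl fun w _ => by
        simp only [hK]; ring
    rw [e]
    refine abs_expect_le_of_forall fun z => ?_
    rw [abs_mul]
    exact (mul_le_of_le_one_left (abs_nonneg _) (hu z)).trans
      (h _ _ _ (fun x => abs_mul_le_one (ht x) (hA.abs_le_one x z))
        (fun x => abs_mul_le_one (hs x) (hA.abs_le_one x z))
        (fun x => abs_mul_le_one (hv x) (hA.abs_le_one z x)))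
  have e : 𝔼 z, 𝔼 w, 𝔼 x, 𝔼 y, A z w * (A x w * A y w - A x z * A y z) * t x * s y * u z * v w
      = (1 / p ^ 3) * ((𝔼 z, 𝔼 w, 𝔼 x, 𝔼 y,
          (K z w x y - p ^ 3 * (A z w * (A x z * A y z) * t x * s y * u z * v w)))
        - 𝔼 z, 𝔼 w, 𝔼 x, 𝔼 y,
          (K z w x y - p ^ 3 * (A z w * (A x w * A y w) * t x * s y * u z * v w))) := by
    have hp : p ≠ 0 := hp0.ne'
    simp only [← expect_sub_distrib, mul_expect]
    exact expect_congr rfl fun x _ => expect_congr rfl fun y _ => expect_congr rfl fun z _ =>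
      expect_congr rfl fun w _ => by field_simp; ring
  have hp3 : 0 < p ^ 3 := by positivity
  rw [e, abs_mul, abs_of_pos (by positivity : 0 < 1 / p ^ 3), ← mul_div_right_comm, one_mul]
  gcongr
  exact (abs_sub _ _).trans (by linarith)

lemma IsUnitKernel.weakSmall₂_mul_sq_ndeg_sub (hA : IsUnitKernel A) (hp0 : 0 < p)
    (h : WeakSmall₃ δ fun x y z => A x y * A y z * A x z - p ^ 3) :
    WeakSmall₂ (2 * δ / p ^ 3) fun z w => A z w * (ndeg A w ^ 2 - ndeg A z ^ 2) := by
  intro u v hu hv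
  refine le_trans (le_of_eq ?_) (hA.abs_expect_star_sub_star_le hp0 h (t := fun _ => 1)
    (s := fun _ => 1) (by simp) (by simp) hu hv)
  congr 1
  refine expect_congr rfl fun z _ => expect_congr rfl fun w _ => ?_
  have e : ∀ w, ndeg A w ^ 2 = 𝔼 x, 𝔼 y, A x w * A y w := fun w => by
    rw [sq, ndeg, expect_mul_expect]
    exact expect_congr rfl fun x _ => expect_congr rfl fun y _ => by rw [hA.symm w x, hA.symm w y]
  beta_reduce
  rw [e, e]
  simp only [← expect_sub_distrib, expect_mul, mul_expect]
  exact expect_congr rfl fun x _ => expect_congr rfl fun y _ => by ring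

lemma IsUnitKernel.weakSmall₂_expect_sub (hA : IsUnitKernel A) (hp0 : 0 < p)
    (h : WeakSmall₃ δ fun x y z => A x y * A y z * A x z - p ^ 3) :
    WeakSmall₂ (2 * δ / p ^ 3)
      fun y z => (𝔼 w, A y w * A z w * ndeg A w) - A y z * ndeg A z ^ 2 := by
  intro s u hs hu
  refine le_trans (le_of_eq ?_) (hA.abs_expect_star_sub_star_le hp0 h (t := fun _ => 1)
    (v := fun _ => 1) (by simp) hs hu (by simp))
  congr 1
  rw [expect_comm]
  refine expect_congr rfl fun z _ => ?_
  rw [expect_congr rfl fun w _ => expect_comm _ _ _, expect_comm]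
  refine expect_congr rfl fun y _ => ?_
  have e : ndeg A z ^ 2 = 𝔼 w, 𝔼 x, A z w * A x z := by
    rw [sq, ndeg, expect_mul_expect]
    exact expect_congr rfl fun w _ => expect_congr rfl fun x _ => by rw [hA.symm z x]
  have e' : 𝔼 w, A y w * A z w * ndeg A w = 𝔼 w, 𝔼 x, A y w * A z w * A x w := by
    refine expect_congr rfl fun w _ => ?_
    rw [ndeg, mul_expect]
    exact expect_congr rfl fun x _ => by rw [hA.symm w x]
  beta_reduce
  rw [e, e']
  simp only [mul_expect, ← expect_sub_distrib, expect_mul]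
  exact expect_congr rfl fun w _ => expect_congr rfl fun x _ => by ring

/-- If triangles are weakly equidistributed, degrees are approximately equal. -/
lemma IsUnitKernel.expect_sq_ndeg_sub_le (hA : IsUnitKernel A) (hp0 : 0 < p)
    (h : WeakSmall₃ δ fun x y z => A x y * A y z * A x z - p ^ 3) :
    𝔼 z, 𝔼 w, (ndeg A w ^ 2 - ndeg A z ^ 2) ^ 2 ≤ (4 * δ + 2 * (2 * δ / p ^ 3)) / p ^ 3 := by
  set d := ndeg A with hd
  have hd1 : ∀ x, |d x| ≤ 1 := hA.abs_ndeg_le_one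
  have one : ∀ x : V, |(fun _ : V => (1 : ℝ)) x| ≤ 1 := by simp
  have hd2 : ∀ x : V, |d x ^ 2| ≤ 1 := fun x => by
    rw [abs_pow]; exact pow_le_one₀ (abs_nonneg _) (hd1 x)
  have hd4 : ∀ x : V, |d x ^ 4| ≤ 1 := fun x => by
    rw [abs_pow]; exact pow_le_one₀ (abs_nonneg _) (hd1 x)
  have hW := hA.weakSmall₂_mul_sq_ndeg_sub hp0 h
  have h1 : 𝔼 z, 𝔼 w, A z w * (d w ^ 2 - d z ^ 2) ^ 2 ≤ 2 * (2 * δ / p ^ 3) := by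
    have e : 𝔼 z, 𝔼 w, A z w * (d w ^ 2 - d z ^ 2) ^ 2
        = (𝔼 z, 𝔼 w, A z w * (d w ^ 2 - d z ^ 2) * 1 * d w ^ 2)
          - 𝔼 z, 𝔼 w, A z w * (d w ^ 2 - d z ^ 2) * d z ^ 2 * 1 := by
      simp only [← expect_sub_distrib]
      exact expect_congr rfl fun z _ => expect_congr rfl fun w _ => by ring
    have a1 := hW (fun _ => 1) (fun w => d w ^ 2) one hd2
    have a2 := hW (fun w => d w ^ 2) (fun _ => 1) hd2 one
    rw [abs_le] at a1 a2
    rw [e]; linarith [a1.2, a2.1]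
  have h2 : |𝔼 x, 𝔼 z, 𝔼 w, (A x z * A z w * A x w - p ^ 3) * (d w ^ 2 - d z ^ 2) ^ 2|
      ≤ 4 * δ := by
    have e : 𝔼 x, 𝔼 z, 𝔼 w, (A x z * A z w * A x w - p ^ 3) * (d w ^ 2 - d z ^ 2) ^ 2
        = (𝔼 x, 𝔼 z, 𝔼 w, (A x z * A z w * A x w - p ^ 3) * 1 * 1 * d w ^ 4)
        + (𝔼 x, 𝔼 z, 𝔼 w, (A x z * A z w * A x w - p ^ 3) * 1 * d z ^ 4 * 1)
        - 2 * (𝔼 x, 𝔼 z, 𝔼 w, (A x z * A z w * A x w - p ^ 3) * 1 * d z ^ 2 * d w ^ 2) := by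
      simp only [← expect_sub_distrib, ← expect_add_distrib, mul_expect (a := (2 : ℝ))]
      exact expect_congr rfl fun x _ => expect_congr rfl fun z _ => expect_congr rfl fun w _ => by
        ring
    have a1 := h _ _ (fun w => d w ^ 4) one one hd4
    have a2 := h _ (fun w => d w ^ 4) _ one hd4 one
    have a3 := h _ (fun w => d w ^ 2) (fun w => d w ^ 2) one hd2 hd2
    rw [abs_le] at a1 a2 a3 ⊢
    rw [e]; constructor <;> linarith
  have h3 : 𝔼 x, 𝔼 z, 𝔼 w, (A x z * A z w * A x w - p ^ 3) * (d w ^ 2 - d z ^ 2) ^ 2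
      ≤ (𝔼 z, 𝔼 w, A z w * (d w ^ 2 - d z ^ 2) ^ 2)
        - p ^ 3 * 𝔼 z, 𝔼 w, (d w ^ 2 - d z ^ 2) ^ 2 := by
    refine expect_le univ_nonempty fun x _ => ?_
    simp only [mul_expect (a := p ^ 3), ← expect_sub_distrib]
    refine expect_mono fun z => expect_mono fun w => ?_
    have b : A x z * A z w * A x w ≤ A z w := by
      have b1 : A x z * A x w ≤ 1 := mul_le_one₀ (hA.le_one _ _) (hA.nonneg _ _) (hA.le_one _ _)
      nlinarith [hA.nonneg z w]
    nlinarith [mul_le_mul_of_nonneg_right b (sq_nonneg (d w ^ 2 - d z ^ 2))]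
  rw [le_div_iff₀ (by positivity)]
  rw [abs_le] at h2
  linarith [h2.1]

lemma IsUnitKernel.expect_abs_ndeg_sub_sqrt_le (hA : IsUnitKernel A) {q k s : ℝ}
    (hq : q = 𝔼 x, ndeg A x ^ 2) (hk : 0 < k) (hkq : k ≤ q)
    (h : 𝔼 z, 𝔼 w, (ndeg A w ^ 2 - ndeg A z ^ 2) ^ 2 ≤ s) :
    𝔼 x, |ndeg A x ^ 2 - q| ≤ √s ∧ 𝔼 x, |ndeg A x - √q| ≤ √s / k := by
  have h1 : 𝔼 x, |ndeg A x ^ 2 - q| ≤ √s := by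
    refine expect_le_sqrt (le_trans (expect_mono fun z => ?_) h)
    have : ndeg A z ^ 2 - q = -𝔼 w, (ndeg A w ^ 2 - ndeg A z ^ 2) := by
      rw [expect_sub_distrib, Fintype.expect_const, hq]; ring
    rw [this, neg_sq]
    exact sq_expect_le _
  refine ⟨h1, ?_⟩
  have hq1 : q ≤ 1 := by
    rw [hq]
    exact expect_le univ_nonempty fun x _ => pow_le_one₀ (hA.ndeg_nonneg x) (hA.ndeg_le_one x)
  have hd0 : k ≤ √q := Real.le_sqrt_of_sq_le (by nlinarith)
  have hsq : √q ^ 2 = q := Real.sq_sqrt (by linarith)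
  rw [le_div_iff₀ hk, expect_mul]
  refine le_trans (expect_mono fun x => ?_) h1
  rw [← hsq, sq_sub_sq, abs_mul, mul_comm,
    abs_of_nonneg (by linarith [hA.ndeg_nonneg x] : 0 ≤ ndeg A x + √q)]
  rw [hsq]
  exact mul_le_mul_of_nonneg_right (by linarith [hA.ndeg_nonneg x]) (abs_nonneg _)

lemma IsUnitKernel.weakSmall₂_ncodeg_sub (hA : IsUnitKernel A) {q d₀ k s t r : ℝ}
    (hk : 0 < k) (hkd : k ≤ d₀)
    (hs : 𝔼 x, |ndeg A x ^ 2 - q| ≤ s) (ht : 𝔼 x, |ndeg A x - d₀| ≤ t) (hq : q = d₀ ^ 2)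
    (h : WeakSmall₂ r fun y z => (𝔼 w, A y w * A z w * ndeg A w) - A y z * ndeg A z ^ 2) :
    WeakSmall₂ ((r + t + s) / k) fun x y => ncodeg A x y - d₀ * A x y := by
  have hd0 : 0 < d₀ := by linarith
  have h1 : WeakSmall₂ t fun y z => 𝔼 w, A y w * A z w * (d₀ - ndeg A w) := by
    refine WeakSmall₂.of_expect_abs_le (le_trans (expect_le univ_nonempty fun y _ =>
      expect_le univ_nonempty fun z _ => ?_) ht)
    refine (abs_expect_le _ _).trans (expect_mono fun w => ?_)
    rw [abs_mul, abs_sub_comm]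
    exact mul_le_of_le_one_left (abs_nonneg _)
      (abs_mul_le_one (hA.abs_le_one y w) (hA.abs_le_one z w))
  have h2 : WeakSmall₂ s fun y z => A y z * (ndeg A z ^ 2 - q) := by
    refine WeakSmall₂.of_expect_abs_le (le_trans (expect_le univ_nonempty fun y _ =>
      expect_mono fun z => ?_) hs)
    rw [abs_mul]
    exact mul_le_of_le_one_left (abs_nonneg _) (hA.abs_le_one y z)
  have h3 := (((h.add h1).add h2).const_mul d₀⁻¹).congr
    (h := fun x y => ncodeg A x y - d₀ * A x y) fun y z => by
      simp only [mul_sub, expect_sub_distrib, ← expect_mul, hq]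
      unfold ncodeg
      field_simp
      ring
  have hnn : 0 ≤ r + t + s := by
    have := ((h.add h1).add h2) (fun _ => 0) (fun _ => 0) (by simp) (by simp)
    exact (abs_nonneg _).trans this
  refine h3.mono ?_
  rw [abs_of_pos (by positivity), inv_mul_eq_div]
  gcongr

lemma IsUnitKernel.expect_abs_ncodeg_sub_le (hA : IsUnitKernel A) {d₀ k e r : ℝ} (hp0 : 0 < p)
    (hp1 : p ≤ 1) (hk : 0 < k) (hkd : k ≤ d₀) (hkp : 2 * k ≤ p ^ 3) (hd1 : d₀ ≤ 1)
    (h : WeakSmall₂ e fun x y => A x y * ncodeg A x y - p ^ 3)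
    (h' : WeakSmall₂ r fun x y => ncodeg A x y - d₀ * A x y) :
    𝔼 x, 𝔼 y, |ncodeg A x y - √(d₀ * p ^ 3)| ≤ √(2 * (r + e)) / (2 * k ^ 2) := by
  have hd0 : 0 < d₀ := by linarith
  have one : ∀ x : V, |(fun _ : V => (1 : ℝ)) x| ≤ 1 := by simp
  set c₂ := d₀ * p ^ 3 with hc₂
  have hp3 : p ^ 3 ≤ 1 := pow_le_one₀ hp0.le hp1
  have hc₂1 : c₂ ≤ 1 := mul_le_one₀ hd1 (by positivity) hp3
  have hc₂k : 2 * k ^ 2 ≤ c₂ := by rw [hc₂]; nlinarith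
  have he : 0 ≤ e := (abs_nonneg _).trans (h (fun _ => 0) (fun _ => 0) (by simp) (by simp))
  have hg : WeakSmall₂ (r + e) fun x y => ncodeg A x y ^ 2 - c₂ := by
    have h1 := (hA.weakSmall₂_mul_ncodeg h').add (h.const_mul d₀)
    refine (h1.mono ?_).congr fun x y => by ring
    rw [abs_of_pos hd0]
    nlinarith
  have hg2 := hA.weakSmall₂_mul_ncodeg (hA.weakSmall₂_mul_ncodeg hg)
  have h2 : 𝔼 x, 𝔼 y, (ncodeg A x y ^ 2 - c₂) ^ 2 ≤ 2 * (r + e) := by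
    have a1 := hg _ _ one one
    have a2 := hg2 _ _ one one
    have e1 : 𝔼 x, 𝔼 y, (ncodeg A x y ^ 2 - c₂) ^ 2
        = (𝔼 x, 𝔼 y, (ncodeg A x y ^ 2 - c₂) * ncodeg A x y * ncodeg A x y * 1 * 1)
          - c₂ * 𝔼 x, 𝔼 y, (ncodeg A x y ^ 2 - c₂) * 1 * 1 := by
      simp only [mul_expect (a := c₂), ← expect_sub_distrib]
      exact expect_congr rfl fun x _ => expect_congr rfl fun y _ => by ring
    have a3 : |c₂ * 𝔼 x, 𝔼 y, (ncodeg A x y ^ 2 - c₂) * 1 * 1| ≤ r + e := by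
      rw [abs_mul, abs_of_pos (by positivity)]
      exact (mul_le_of_le_one_left (abs_nonneg _) hc₂1).trans a1
    rw [abs_le] at a2 a3
    rw [e1]
    linarith [a2.2, a3.1]
  have h3 := expect₂_le_sqrt h2
  have hsq : √c₂ ^ 2 = c₂ := Real.sq_sqrt (by positivity)
  have hc : 2 * k ^ 2 ≤ √c₂ := Real.le_sqrt_of_sq_le (by nlinarith)
  rw [le_div_iff₀ (by positivity), expect_mul]
  refine le_trans (expect_mono fun x => ?_) h3
  rw [expect_mul]
  refine expect_mono fun y => ?_
  have hM := hA.ncodeg_nonneg x y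
  nth_rw 2 [← hsq]
  rw [sq_sub_sq, abs_mul, mul_comm, abs_of_nonneg (by linarith [Real.sqrt_nonneg c₂] :
    0 ≤ ncodeg A x y + √c₂)]
  exact mul_le_mul_of_nonneg_right (by linarith) (abs_nonneg _)

lemma weakSmall₂_of_ncodeg_sub {d₀ k e r : ℝ} (hp0 : 0 < p)
    (hp1 : p ≤ 1) (hk : 0 < k) (hkq : k ≤ d₀ ^ 2) (hkd : k ≤ d₀) (hd1 : d₀ ≤ 1)
    (hq : d₀ ^ 2 = 𝔼 x, 𝔼 y, ncodeg A x y)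
    (h : 𝔼 x, 𝔼 y, |ncodeg A x y - √(d₀ * p ^ 3)| ≤ e)
    (h' : WeakSmall₂ r fun x y => ncodeg A x y - d₀ * A x y) :
    WeakSmall₂ ((r + 2 * e) / k + 2 * e / k ^ 2) fun x y => A x y - p := by
  have hd0 : 0 < d₀ := by linarith
  set c := √(d₀ * p ^ 3) with hc
  have hc0 : 0 ≤ c := Real.sqrt_nonneg _
  have hsq : c ^ 2 = d₀ * p ^ 3 := Real.sq_sqrt (by positivity)
  have hp3 : p ^ 3 ≤ 1 := pow_le_one₀ hp0.le hp1
  have hc1 : c ≤ 1 := by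
    rw [hc, Real.sqrt_le_one]
    exact mul_le_one₀ hd1 (by positivity) hp3
  have hqc : |d₀ ^ 2 - c| ≤ e := by
    have : d₀ ^ 2 - c = 𝔼 x, 𝔼 y, (ncodeg A x y - c) := by
      simp only [expect_sub_distrib, Fintype.expect_const, hq]
    rw [this]
    refine (abs_expect_le _ _).trans (le_trans (expect_mono fun x => ?_) h)
    exact abs_expect_le _ _
  have h1 : WeakSmall₂ (2 * e) fun x y => ncodeg A x y - d₀ ^ 2 := by
    refine WeakSmall₂.of_expect_abs_le ?_
    have : 𝔼 x, 𝔼 y, |ncodeg A x y - d₀ ^ 2| ≤ 𝔼 x, 𝔼 y, (|ncodeg A x y - c| + e) := by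
      refine expect_mono fun x => expect_mono fun y => ?_
      refine (abs_sub_le _ c _).trans ?_
      rw [abs_sub_comm c]
      linarith
    simp only [expect_add_distrib, Fintype.expect_const] at this
    linarith
  have hre : 0 ≤ r + 2 * e :=
    (abs_nonneg _).trans ((h'.add h1) (fun _ => 0) (fun _ => 0) (by simp) (by simp))
  have h2 : WeakSmall₂ ((r + 2 * e) / k) fun x y => A x y - d₀ := by
    refine (((h1.sub h').const_mul d₀⁻¹).mono ?_).congr fun x y => by field_simp; ring
    rw [abs_of_pos (by positivity), inv_mul_eq_div, add_comm]
    gcongr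
  have h3 : |d₀ - p| ≤ 2 * e / k ^ 2 := by
    rw [le_div_iff₀ (by positivity)]
    have e1 : (d₀ ^ 2 - c) * (d₀ ^ 2 + c) = (d₀ - p) * (d₀ * (d₀ ^ 2 + d₀ * p + p ^ 2)) := by
      linear_combination -hsq
    have e2 := congrArg abs e1
    rw [abs_mul, abs_mul, abs_of_nonneg (by positivity : 0 ≤ d₀ ^ 2 + c),
      abs_of_nonneg (by positivity : 0 ≤ d₀ * (d₀ ^ 2 + d₀ * p + p ^ 2))] at e2
    have e3 : |d₀ ^ 2 - c| * (d₀ ^ 2 + c) ≤ e * 2 := by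
      have : d₀ ^ 2 ≤ 1 := pow_le_one₀ hd0.le hd1
      exact mul_le_mul hqc (by linarith) (by positivity) ((abs_nonneg _).trans hqc)
    have e4 : k ^ 2 ≤ d₀ * (d₀ ^ 2 + d₀ * p + p ^ 2) := by
      rw [sq]
      exact mul_le_mul hkd (by nlinarith [mul_pos hd0 hp0, sq_nonneg p]) hk.le hd0.le
    have := mul_le_mul_of_nonneg_left e4 (abs_nonneg (d₀ - p))
    linarith
  refine (h2.add (WeakSmall₂.of_expect_abs_le (g := fun _ _ => d₀ - p) ?_)).congr
    fun x y => by ring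
  simpa using h3

lemma IsUnitKernel.weakSmall₂_of_triangle (hA : IsUnitKernel A) {k s r e : ℝ} (hp0 : 0 < p)
    (hp1 : p ≤ 1) (hk : k = p ^ 3 / 2) (hδ : δ ≤ k)
    (h : WeakSmall₃ δ fun x y z => A x y * A y z * A x z - p ^ 3)
    (hs : s = √((4 * δ + 2 * (2 * δ / p ^ 3)) / p ^ 3)) (hr : r = (2 * δ / p ^ 3 + s / k + s) / k)
    (he : e = √(2 * (r + δ)) / (2 * k ^ 2)) :
    WeakSmall₂ ((r + 2 * e) / k + 2 * e / k ^ 2) fun x y => A x y - p := by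
  have one : ∀ x : V, |(fun _ : V => (1 : ℝ)) x| ≤ 1 := by simp
  have hk0 : 0 < k := by rw [hk]; positivity
  set q := 𝔼 x, ndeg A x ^ 2 with hq
  have hqM : q = 𝔼 x, 𝔼 y, ncodeg A x y := by
    unfold ncodeg
    rw [← expect_rotate₃ fun x y z => A x z * A y z]
    refine expect_congr rfl fun z _ => ?_
    rw [sq, ndeg, expect_mul_expect]
    exact expect_congr rfl fun x _ => expect_congr rfl fun y _ => by
      rw [hA.symm z x, hA.symm z y]
  have hT : WeakSmall₂ δ fun x y => A x y * ncodeg A x y - p ^ 3 := by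
    intro u v hu hv
    refine le_trans (le_of_eq ?_) (h u v _ hu hv one)
    congr 1
    refine expect_congr rfl fun x _ => expect_congr rfl fun y _ => ?_
    simp only [mul_one, ← expect_mul, expect_sub_distrib, Fintype.expect_const]
    congr 3
    rw [ncodeg, mul_expect]
    exact expect_congr rfl fun z _ => by ring
  have hkq : k ≤ q := by
    have h1 := hT _ _ one one
    have h2 : 𝔼 x, 𝔼 y, (A x y * ncodeg A x y - p ^ 3) * 1 * 1 ≤ q - p ^ 3 := by
      have : q - p ^ 3 = 𝔼 x, 𝔼 y, (ncodeg A x y - p ^ 3) := by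
        simp only [expect_sub_distrib, Fintype.expect_const, hqM]
      rw [this]
      refine expect_mono fun x => expect_mono fun y => ?_
      nlinarith [hA.ncodeg_nonneg x y, hA.le_one x y]
    rw [abs_le] at h1
    linarith [h1.1]
  have hq1 : q ≤ 1 :=
    expect_le univ_nonempty fun x _ => pow_le_one₀ (hA.ndeg_nonneg x) (hA.ndeg_le_one x)
  have hsq : √q ^ 2 = q := Real.sq_sqrt (by linarith)
  have hkd : k ≤ √q := Real.le_sqrt_of_sq_le (by nlinarith)
  have hd1 : √q ≤ 1 := Real.sqrt_le_one.2 hq1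
  obtain ⟨h1, h2⟩ := hA.expect_abs_ndeg_sub_sqrt_le hq hk0 hkq (hA.expect_sq_ndeg_sub_le hp0 h)
  rw [← hs] at h1 h2
  have h3 := hA.weakSmall₂_ncodeg_sub hk0 hkd h1 h2 hsq.symm (hA.weakSmall₂_expect_sub hp0 h)
  rw [← hr] at h3
  have h4 := hA.expect_abs_ncodeg_sub_le hp0 hp1 hk0 hkd (by rw [hk]; linarith) hd1 hT h3
  rw [← he] at h4
  exact _root_.weakSmall₂_of_ncodeg_sub hp0 hp1 hk0 (by rw [hsq]; exact hkq) hkd hd1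
    (by rw [hsq]; exact hqM) h4 h3

/-- If the density of triangles is weakly constant, then the kernel is weakly constant. -/
lemma exists_weakSmall₂_of_triangle (hp0 : 0 < p) (hp1 : p ≤ 1) {ε : ℝ} (hε : 0 < ε) :
    ∃ δ > 0, ∀ (V : Type) [Fintype V] [Nonempty V] (A : V → V → ℝ), IsUnitKernel A →
      (WeakSmall₃ δ fun x y z => A x y * A y z * A x z - p ^ 3) →
      WeakSmall₂ ε fun x y => A x y - p := by
  set k := p ^ 3 / 2 with hk
  have hk0 : 0 < k := by positivity
  let s : ℝ → ℝ := fun δ => √((4 * δ + 2 * (2 * δ / p ^ 3)) / p ^ 3)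
  let r : ℝ → ℝ := fun δ => (2 * δ / p ^ 3 + s δ / k + s δ) / k
  let e : ℝ → ℝ := fun δ => √(2 * (r δ + δ)) / (2 * k ^ 2)
  let g : ℝ → ℝ := fun δ => (r δ + 2 * e δ) / k + 2 * e δ / k ^ 2
  have hc : Tendsto g (nhdsWithin 0 (Set.Ioi 0)) (nhds 0) := by
    have hg : Continuous g := by
      simp only [g, e, r, s]
      fun_prop
    have := hg.tendsto 0
    have h0 : g 0 = 0 := by simp [g, e, r, s]
    rw [h0] at this
    exact this.mono_left nhdsWithin_le_nhds
  obtain ⟨δ, hδ, hδk, hδ0⟩ := ((hc.eventually (ge_mem_nhds hε)).and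
    ((eventually_nhdsWithin_of_eventually_nhds (ge_mem_nhds hk0)).and
      eventually_mem_nhdsWithin)).exists
  exact ⟨δ, hδ0, fun V _ _ A hA h =>
    (hA.weakSmall₂_of_triangle hp0 hp1 hk hδk h rfl rfl rfl).mono hδ⟩

end Triangle

/-- The indicator function of a finite set. -/
def finInd {V : Type} [DecidableEq V] (U : Finset V) : V → ℝ := fun x => if x ∈ U then 1 else 0

lemma abs_finInd_le_one {V : Type} [DecidableEq V] (U : Finset V) (x : V) : |finInd U x| ≤ 1 := by
  unfold finInd; split_ifs <;> simp

lemma finInd_eq_zero {V : Type} [DecidableEq V] {U : Finset V} {x : V} (h : x ∉ U) : finInd U x = 0 := if_neg h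

section Rounding

variable {V : Type} [Fintype V] [DecidableEq V]

lemma sum_finInd (U : Finset V) : ∑ x, finInd U x = U.card := by
  simp [finInd]

lemma eq_finInd_of_forall {μ : V → ℝ} (h : ∀ x, μ x = 0 ∨ μ x = 1) :
    μ = finInd (univ.filter fun x => μ x = 1) := by
  funext x
  rcases h x with h | h <;> simp [finInd, h]

lemma exists_pair_of_sum_eq_natCast {μ : V → ℝ} {k : ℕ} (hs : ∑ x, μ x = k)
    {x : V} (hx0 : 0 < μ x) (hx1 : μ x < 1) (h : ∀ y, 0 ≤ μ y ∧ μ y ≤ 1) :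
    ∃ y, y ≠ x ∧ 0 < μ y ∧ μ y < 1 := by
  by_contra! hcon
  have h1 : ∀ y ∈ univ.erase x, μ y = if μ y = 1 then 1 else 0 := by
    intro y hy
    split_ifs with hy1
    · exact hy1
    · by_contra hy0
      exact hy1 (le_antisymm (h y).2
        (hcon y (ne_of_mem_erase hy) (lt_of_le_of_ne (h y).1 (Ne.symm hy0))))
  have h2 := add_sum_erase univ μ (mem_univ x)
  rw [hs, sum_congr rfl h1, sum_boole] at h2
  set c := #{y ∈ univ.erase x | μ y = 1}
  have h3 : (c : ℝ) < k := by linarith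
  have h4 : (k : ℝ) < c + 1 := by linarith
  have h5 : c < k := by exact_mod_cast h3
  have h6 : k < c + 1 := by exact_mod_cast h4
  omega

/-- Moving mass between two fractional coordinates until one of them becomes integral does not
decrease a quadratic form by more than the bound on its second differences. -/
lemma exists_shift_of_pair (B : (V → ℝ) →ₗ[ℝ] (V → ℝ) →ₗ[ℝ] ℝ) {K : ℝ}
    (hK : ∀ x y, |B (Pi.single x 1 - Pi.single y 1) (Pi.single x 1 - Pi.single y 1)| ≤ K)
    {μ : V → ℝ} {x y : V} (hxy : y ≠ x) (hx : 0 < μ x ∧ μ x < 1) (hy : 0 < μ y ∧ μ y < 1)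
    (hL : 0 ≤ B μ (Pi.single x 1 - Pi.single y 1) + B (Pi.single x 1 - Pi.single y 1) μ) :
    ∃ μ' : V → ℝ, (∀ z, z ≠ x → z ≠ y → μ' z = μ z) ∧ ∑ z, μ' z = ∑ z, μ z ∧
      (0 ≤ μ' x ∧ μ' x ≤ 1) ∧ (0 ≤ μ' y ∧ μ' y ≤ 1) ∧ (μ' x = 1 ∨ μ' y = 0) ∧
      B μ μ - K ≤ B μ' μ' := by
  set t := min (1 - μ x) (μ y) with ht
  have ht0 : 0 ≤ t := le_min (by linarith) hy.1.le
  have ht1 : t ≤ 1 := (min_le_right _ _).trans hy.2.le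
  have htx : t ≤ 1 - μ x := min_le_left _ _
  have hty : t ≤ μ y := min_le_right _ _
  set e : V → ℝ := Pi.single x 1 - Pi.single y 1 with he
  have ex : e x = 1 := by simp [he, hxy.symm]
  have ey : e y = -1 := by simp [he, hxy]
  refine ⟨μ + t • e, fun z hzx hzy => ?_, ?_, ?_, ?_, ?_, ?_⟩
  · simp [he, hzx, hzy]
  · simp [he, sum_add_distrib, ← mul_sum, Pi.single_apply]
  · simp only [Pi.add_apply, Pi.smul_apply, ex, smul_eq_mul]
    constructor <;> linarith
  · simp only [Pi.add_apply, Pi.smul_apply, ey, smul_eq_mul]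
    constructor <;> linarith
  · simp only [Pi.add_apply, Pi.smul_apply, ex, ey, smul_eq_mul]
    rcases le_total (1 - μ x) (μ y) with h | h
    · left; rw [ht, min_eq_left h]; ring
    · right; rw [ht, min_eq_right h]; ring
  · simp only [map_add, map_smul, LinearMap.add_apply, LinearMap.smul_apply, smul_eq_mul]
    have h1 := (abs_le.1 (hK x y)).1
    have hK0 : 0 ≤ K := (abs_nonneg _).trans (hK x y)
    have h2 : -K ≤ t * (t * B e e) := by
      have : t * t ≤ 1 := mul_le_one₀ ht1 ht0 ht1
      nlinarith [mul_nonneg ht0 ht0]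
    have h3 := mul_nonneg ht0 hL
    linarith

/-- A quadratic form with bounded second differences can be rounded from a fractional point of
integral mass to the indicator of a set, losing little. -/
lemma exists_finset_le_quadratic (B : (V → ℝ) →ₗ[ℝ] (V → ℝ) →ₗ[ℝ] ℝ) {K : ℝ}
    (hK : ∀ x y, |B (Pi.single x 1 - Pi.single y 1) (Pi.single x 1 - Pi.single y 1)| ≤ K)
    (hK0 : 0 ≤ K) {k : ℕ} (j : ℕ) : ∀ μ : V → ℝ, (∀ x, 0 ≤ μ x ∧ μ x ≤ 1) → ∑ x, μ x = k →
      #{x | 0 < μ x ∧ μ x < 1} ≤ j →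
      ∃ U : Finset V, U.card = k ∧ (∀ x ∈ U, μ x ≠ 0) ∧ B μ μ - K * j ≤ B (finInd U) (finInd U) := by
  induction j with
  | zero =>
    intro μ hμ hs hj
    have h : ∀ x, μ x = 0 ∨ μ x = 1 := by
      intro x
      by_contra! hx
      have : x ∈ ({x | 0 < μ x ∧ μ x < 1} : Finset V) := by
        simp [lt_of_le_of_ne (hμ x).1 (Ne.symm hx.1), lt_of_le_of_ne (hμ x).2 hx.2]
      simp [card_eq_zero.1 (Nat.le_zero.1 hj)] at this
    have e := eq_finInd_of_forall h
    refine ⟨univ.filter fun x => μ x = 1, ?_, fun x hx => ?_, ?_⟩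
    · rw [e, sum_finInd] at hs
      exact_mod_cast hs
    · simp [(mem_filter.1 hx).2]
    · rw [← e]; simp
  | succ j ih =>
    intro μ hμ hs hj
    by_cases hfr : ∃ x, 0 < μ x ∧ μ x < 1
    · obtain ⟨x, hx⟩ := hfr
      obtain ⟨y, hyx, hy⟩ := exists_pair_of_sum_eq_natCast hs hx.1 hx.2 hμ
      wlog hL : 0 ≤ B μ (Pi.single x 1 - Pi.single y 1) + B (Pi.single x 1 - Pi.single y 1) μ
          generalizing x y
      · refine this y hy x hyx.symm hx ?_
        have : (Pi.single y 1 - Pi.single x 1 : V → ℝ) = -(Pi.single x 1 - Pi.single y 1) := by simp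
        rw [this]
        simp only [map_neg, LinearMap.neg_apply]
        linarith
      obtain ⟨μ', h1, h2, h3, h4, h5, h6⟩ := exists_shift_of_pair B hK hyx hx hy hL
      obtain ⟨U, hU, hUμ, hB⟩ := ih μ' (fun z => by
          by_cases hzx : z = x
          · rw [hzx]; exact h3
          by_cases hzy : z = y
          · rw [hzy]; exact h4
          rw [h1 z hzx hzy]; exact hμ z) (h2.trans hs) (by
          have : ({z | 0 < μ' z ∧ μ' z < 1} : Finset V) ⊂ ({z | 0 < μ z ∧ μ z < 1} : Finset V) := by
            refine (ssubset_iff_of_subset fun z hz => ?_).2 ?_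
            · by_cases hzx : z = x
              · rw [hzx]; simpa using hx
              by_cases hzy : z = y
              · rw [hzy]; simpa using hy
              simp only [mem_filter, mem_univ, true_and] at hz ⊢
              rwa [h1 z hzx hzy] at hz
            · rcases h5 with h5 | h5
              · exact ⟨x, by simpa using hx, by simp [h5]⟩
              · exact ⟨y, by simpa using hy, by simp [h5]⟩
          have := card_lt_card this
          omega)
      refine ⟨U, hU, fun z hz hz0 => ?_, ?_⟩
      · by_cases hzx : z = x
        · rw [hzx] at hz0; linarith
        by_cases hzy : z = y
        · rw [hzy] at hz0; linarith
        exact hUμ z hz (by rw [h1 z hzx hzy, hz0])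
      · push_cast
        linarith
    · obtain ⟨U, hU, hUμ, hB⟩ := ih μ hμ hs (by
        have : ({z | 0 < μ z ∧ μ z < 1} : Finset V) = ∅ := by
          ext z
          simp only [mem_filter, mem_univ, true_and, notMem_empty, iff_false]
          exact fun hz => hfr ⟨z, hz⟩
        rw [this]; simp)
      refine ⟨U, hU, hUμ, le_trans ?_ hB⟩
      push_cast
      linarith

lemma abs_quadratic_le_of_finset (B : (V → ℝ) →ₗ[ℝ] (V → ℝ) →ₗ[ℝ] ℝ) {K D : ℝ}
    (hK : ∀ x y, |B (Pi.single x 1 - Pi.single y 1) (Pi.single x 1 - Pi.single y 1)| ≤ K)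
    (hK0 : 0 ≤ K) {Y : Finset V} {k : ℕ}
    (hD : ∀ U ⊆ Y, U.card = k → |B (finInd U) (finInd U)| ≤ D)
    {μ : V → ℝ} (hμ : ∀ x, 0 ≤ μ x ∧ μ x ≤ 1) (hs : ∑ x, μ x = k) (hY : ∀ x ∉ Y, μ x = 0) :
    |B μ μ| ≤ D + K * Fintype.card V := by
  have hsub : ∀ U : Finset V, (∀ x ∈ U, μ x ≠ 0) → U ⊆ Y := fun U hU x hx => by
    by_contra h
    exact hU x hx (hY x h)
  obtain ⟨U, hU, hUμ, hB⟩ :=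
    exists_finset_le_quadratic B hK hK0 (Fintype.card V) μ hμ hs (card_le_univ _)
  obtain ⟨U', hU', hUμ', hB'⟩ :=
    exists_finset_le_quadratic (-B) (K := K) (fun x y => by
      simpa only [LinearMap.neg_apply, abs_neg] using hK x y) hK0 (Fintype.card V) μ hμ hs
      (card_le_univ _)
  have h1 := abs_le.1 (hD U (hsub U hUμ) hU)
  have h2 := abs_le.1 (hD U' (hsub U' hUμ') hU')
  simp only [LinearMap.neg_apply] at hB'
  rw [abs_le]
  constructor <;> linarith [h1.1, h1.2, h2.1, h2.2]

/-- A quadratic form that is small on indicators of `k`-subsets of `Y` is small on all bounded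
functions supported on `Y`. -/
lemma abs_quadratic_le (B : (V → ℝ) →ₗ[ℝ] (V → ℝ) →ₗ[ℝ] ℝ) {K D κ : ℝ}
    (hK : ∀ x y, |B (Pi.single x 1 - Pi.single y 1) (Pi.single x 1 - Pi.single y 1)| ≤ K)
    (hK0 : 0 ≤ K) {Y : Finset V} (hYne : Y.Nonempty) {k : ℕ} (hκ : 0 < κ) (hκ1 : κ * Y.card ≤ k)
    (hκ2 : k + κ * Y.card ≤ Y.card)
    (hD : ∀ U ⊆ Y, U.card = k → |B (finInd U) (finInd U)| ≤ D)
    {u : V → ℝ} (hu : ∀ x, |u x| ≤ 1) (hY : ∀ x ∉ Y, u x = 0) :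
    |B u u| ≤ 11 * (D + K * Fintype.card V) / κ ^ 2 := by
  set D' := D + K * Fintype.card V with hD'
  have hn : (0 : ℝ) < Y.card := by exact_mod_cast hYne.card_pos
  set n : ℝ := (Y.card : ℝ) with hn'
  set c : ℝ := k / n with hc
  have hcn : c * n = k := div_mul_cancel₀ _ hn.ne'
  have hc1 : κ ≤ c := by rw [hc, le_div_iff₀ hn]; exact hκ1
  have hc2 : c + κ ≤ 1 := by
    have : (c + κ) * n ≤ 1 * n := by rw [add_mul, hcn, one_mul]; exact hκ2
    exact le_of_mul_le_mul_right this hn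
  have hc0 : 0 < c := by linarith
  have main : ∀ h : V → ℝ, (∀ x, |h x| ≤ κ) → (∀ x ∉ Y, h x = 0) → ∑ x, h x = 0 →
      |B (c • finInd Y + h) (c • finInd Y + h)| ≤ D' := by
    intro h h1 h2 h3
    refine abs_quadratic_le_of_finset B hK hK0 hD (fun x => ?_) ?_ fun x hx => ?_
    · simp only [Pi.add_apply, Pi.smul_apply, smul_eq_mul]
      by_cases hx : x ∈ Y
      · have := abs_le.1 (h1 x)
        simp only [finInd, hx, if_true]
        constructor <;> linarith [this.1, this.2]
      · simp [finInd, hx, h2 x hx]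
    · simp only [Pi.add_apply, Pi.smul_apply, smul_eq_mul, sum_add_distrib, ← mul_sum, h3,
        sum_finInd]
      rw [add_zero, ← hn', hcn]
    · simp [finInd, hx, h2 x hx]
  set m : ℝ := (∑ x, u x) / n with hm
  have hsum : |∑ x, u x| ≤ n := by
    have : ∑ x, u x = ∑ x ∈ Y, u x := (sum_subset (subset_univ _) fun x _ hx => hY x hx).symm
    rw [this]
    refine (abs_sum_le_sum_abs _ _).trans ((sum_le_sum fun x _ => hu x).trans ?_)
    simp [hn']
  have hm1 : |m| ≤ 1 := by
    rw [hm, abs_div, abs_of_pos hn, div_le_one hn]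
    exact hsum
  set h : V → ℝ := u - m • finInd Y with hh
  have hu' : u = m • finInd Y + h := by rw [hh]; abel
  have hh1 : ∀ x, |h x| ≤ 2 := by
    intro x
    simp only [hh, Pi.sub_apply, Pi.smul_apply, smul_eq_mul]
    exact (abs_sub _ _).trans
      ((add_le_add (hu x) (abs_mul_le_one hm1 (abs_finInd_le_one Y x))).trans (by norm_num))
  have hh2 : ∀ x ∉ Y, h x = 0 := fun x hx => by simp [hh, finInd, hx, hY x hx]
  have hh3 : ∑ x, h x = 0 := by
    simp only [hh, Pi.sub_apply, Pi.smul_apply, smul_eq_mul, sum_sub_distrib, ← mul_sum, sum_finInd]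
    rw [hm, ← hn', div_mul_cancel₀ _ hn.ne', sub_self]
  have b0 := main 0 (fun x => by simpa using hκ.le) (by simp) (by simp)
  have b1 := main ((κ / 2) • h) (fun x => by
    simp only [Pi.smul_apply, smul_eq_mul, abs_mul, abs_of_pos (half_pos hκ)]
    nlinarith [hh1 x]) (fun x hx => by simp [hh2 x hx]) (by simp [← mul_sum, hh3])
  have b2 := main ((-(κ / 2)) • h) (fun x => by
    simp only [Pi.smul_apply, smul_eq_mul, abs_mul, abs_neg, abs_of_pos (half_pos hκ)]
    nlinarith [hh1 x]) (fun x hx => by simp [hh2 x hx]) (by simp [← mul_sum, hh3])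
  simp only [map_add, map_smul, LinearMap.add_apply, LinearMap.smul_apply, smul_eq_mul,
    add_zero] at b0 b1 b2
  set P := B (finInd Y) (finInd Y)
  set X := B (finInd Y) h + B h (finInd Y) with hX
  set H := B h h
  have hD0 : 0 ≤ D' := (abs_nonneg _).trans b0
  have hBu : B u u = m ^ 2 * P + m * X + H := by
    rw [hu']
    simp only [map_add, map_smul, LinearMap.add_apply, LinearMap.smul_apply, smul_eq_mul]
    ring
  rw [abs_le] at b0 b1 b2
  have hP : |κ ^ 2 * P| ≤ D' := by
    have h1 : |c ^ 2 * P| ≤ D' := abs_le.2 ⟨by linarith [b0.1], by linarith [b0.2]⟩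
    rw [abs_mul, abs_of_pos (pow_pos hc0 2)] at h1
    rw [abs_mul, abs_of_pos (by positivity : 0 < κ ^ 2)]
    exact (mul_le_mul_of_nonneg_right (by gcongr) (abs_nonneg _)).trans h1
  have hXb : |κ ^ 2 * X| ≤ 2 * D' := by
    have h1 : |c * κ * X| ≤ 2 * D' := by
      have e : c * κ * X = (c * (c * P) + κ / 2 * (c * B (finInd Y) h)
        + (c * (κ / 2 * (B h) (finInd Y)) + κ / 2 * (κ / 2 * H)))
        - (c * (c * P) + -(κ / 2) * (c * B (finInd Y) h)
        + (c * (-(κ / 2) * (B h) (finInd Y)) + -(κ / 2) * (-(κ / 2) * H))) := by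
        rw [hX]; ring
      rw [abs_le]
      constructor <;> linarith [b1.1, b1.2, b2.1, b2.2]
    have h2 : κ ^ 2 ≤ c * κ := by nlinarith
    rw [abs_mul, abs_of_pos (mul_pos hc0 hκ)] at h1
    rw [abs_mul, abs_of_pos (by positivity : 0 < κ ^ 2)]
    exact (mul_le_mul_of_nonneg_right h2 (abs_nonneg _)).trans h1
  have hH : |κ ^ 2 * H| ≤ 8 * D' := by
    rw [abs_le]
    constructor <;> linarith [b1.1, b1.2, b2.1, b2.2, b0.1, b0.2]
  rw [le_div_iff₀ (by positivity), ← abs_of_pos (by positivity : 0 < κ ^ 2), ← abs_mul, hBu]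
  have e : (m ^ 2 * P + m * X + H) * κ ^ 2
      = m ^ 2 * (κ ^ 2 * P) + m * (κ ^ 2 * X) + κ ^ 2 * H := by ring
  rw [e]
  have t1 : |m ^ 2 * (κ ^ 2 * P)| ≤ D' := by
    rw [abs_mul, abs_pow]
    exact (mul_le_of_le_one_left (abs_nonneg _) (pow_le_one₀ (abs_nonneg _) hm1)).trans hP
  have t2 : |m * (κ ^ 2 * X)| ≤ 2 * D' := by
    rw [abs_mul]
    exact (mul_le_of_le_one_left (abs_nonneg _) hm1).trans hXb
  refine (abs_add_three _ _ _).trans ?_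
  linarith

lemma abs_bilinear_le (B : (V → ℝ) →ₗ[ℝ] (V → ℝ) →ₗ[ℝ] ℝ) {K D κ : ℝ}
    (hB : ∀ u v, B u v = B v u)
    (hK : ∀ x y, |B (Pi.single x 1 - Pi.single y 1) (Pi.single x 1 - Pi.single y 1)| ≤ K)
    (hK0 : 0 ≤ K) {Y : Finset V} (hYne : Y.Nonempty) {k : ℕ} (hκ : 0 < κ) (hκ1 : κ * Y.card ≤ k)
    (hκ2 : k + κ * Y.card ≤ Y.card)
    (hD : ∀ U ⊆ Y, U.card = k → |B (finInd U) (finInd U)| ≤ D)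
    {u v : V → ℝ} (hu : ∀ x, |u x| ≤ 1) (hv : ∀ x, |v x| ≤ 1)
    (hYu : ∀ x ∉ Y, u x = 0) (hYv : ∀ x ∉ Y, v x = 0) :
    |B u v| ≤ 22 * (D + K * Fintype.card V) / κ ^ 2 := by
  have h1 := abs_quadratic_le B hK hK0 hYne hκ hκ1 hκ2 hD (u := (1 / 2 : ℝ) • (u + v))
    (fun x => by
      have a := abs_le.1 (hu x)
      have b := abs_le.1 (hv x)
      simp only [Pi.smul_apply, Pi.add_apply, smul_eq_mul]
      rw [abs_le]; constructor <;> linarith [a.1, a.2, b.1, b.2])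
    (fun x hx => by simp [hYu x hx, hYv x hx])
  have h2 := abs_quadratic_le B hK hK0 hYne hκ hκ1 hκ2 hD (u := (1 / 2 : ℝ) • (u - v))
    (fun x => by
      have a := abs_le.1 (hu x)
      have b := abs_le.1 (hv x)
      simp only [Pi.smul_apply, Pi.sub_apply, smul_eq_mul]
      rw [abs_le]; constructor <;> linarith [a.1, a.2, b.1, b.2])
    (fun x hx => by simp [hYu x hx, hYv x hx])
  have e : B u v = B ((1 / 2 : ℝ) • (u + v)) ((1 / 2 : ℝ) • (u + v))
      - B ((1 / 2 : ℝ) • (u - v)) ((1 / 2 : ℝ) • (u - v)) := by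
    simp only [map_add, map_sub, map_smul, LinearMap.add_apply, LinearMap.sub_apply,
      LinearMap.smul_apply, smul_eq_mul, hB v u]
    ring
  rw [e]
  refine (abs_sub _ _).trans ((add_le_add h1 h2).trans (le_of_eq ?_))
  ring

lemma abs_linear_le (l : (V → ℝ) →ₗ[ℝ] ℝ) {D κ : ℝ} {Y : Finset V} (hYne : Y.Nonempty) {k : ℕ}
    (hκ : 0 < κ) (hκ1 : κ * Y.card ≤ k) (hκ2 : k + κ * Y.card ≤ Y.card)
    (hD : ∀ U ⊆ Y, U.card = k → |l (finInd U)| ≤ D)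
    {u : V → ℝ} (hu : ∀ x, |u x| ≤ 1) (hYu : ∀ x ∉ Y, u x = 0) :
    |l u| ≤ 66 * D / κ ^ 2 := by
  have hn : (0 : ℝ) < Y.card := by exact_mod_cast hYne.card_pos
  have hkY : (k : ℝ) ≤ Y.card := le_trans (by linarith [mul_pos hκ hn]) hκ2
  obtain ⟨U₀, hU₀, hU₀k⟩ := exists_subset_card_eq (s := Y) (n := k) (by exact_mod_cast hkY)
  have hD0 : 0 ≤ D := (abs_nonneg _).trans (hD U₀ hU₀ hU₀k)
  let s : (V → ℝ) →ₗ[ℝ] ℝ := ∑ x, LinearMap.proj x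
  have hs : ∀ w, s w = ∑ x, w x := fun w => by simp [s]
  let B : (V → ℝ) →ₗ[ℝ] (V → ℝ) →ₗ[ℝ] ℝ := l.smulRight s + s.smulRight l
  have hB : ∀ v w, B v w = l v * s w + s v * l w := fun v w => by simp [B]
  have key : ∀ v w : V → ℝ, (∀ x, |v x| ≤ 1) → (∀ x, |w x| ≤ 1) → (∀ x ∉ Y, v x = 0) →
      (∀ x ∉ Y, w x = 0) → |B v w| ≤ 22 * (2 * D * Y.card) / κ ^ 2 := by
    intro v w hv hw hYv hYw
    have := abs_bilinear_le B (K := 0) (D := 2 * D * Y.card)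
      (fun u v => by rw [hB, hB]; ring) (fun x y => by
        have : s (Pi.single x 1 - Pi.single y 1) = 0 := by simp [hs]
        rw [hB, this]; simp) le_rfl hYne hκ hκ1 hκ2 (fun U hU hUk => by
        rw [hB, hs, sum_finInd, hUk]
        have h1 := hD U hU hUk
        have e : l (finInd U) * k + k * l (finInd U) = 2 * l (finInd U) * k := by ring
        rw [e, abs_mul, abs_mul, abs_two, Nat.abs_cast]
        gcongr) hv hw hYv hYw
    simpa using this
  have hY0 : ∀ x ∉ Y, finInd Y x = 0 := fun x hx => finInd_eq_zero hx
  have k1 := key (finInd Y) (finInd Y) (abs_finInd_le_one Y) (abs_finInd_le_one Y) hY0 hY0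
  have k2 := key u (finInd Y) hu (abs_finInd_le_one Y) hYu hY0
  rw [hB, hs, sum_finInd] at k1 k2
  rw [hs] at k2
  set n : ℝ := (Y.card : ℝ) with hn'
  have hsum : |∑ x, u x| ≤ n := by
    have : ∑ x, u x = ∑ x ∈ Y, u x := (sum_subset (subset_univ _) fun x _ hx => hYu x hx).symm
    rw [this]
    refine (abs_sum_le_sum_abs _ _).trans ((sum_le_sum fun x _ => hu x).trans ?_)
    simp [hn']
  have e1 : 22 * (2 * D * n) / κ ^ 2 = n * (44 * D / κ ^ 2) := by ring
  rw [e1] at k1 k2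
  have k3 : |l (finInd Y)| ≤ 22 * D / κ ^ 2 := by
    have e : l (finInd Y) * n + n * l (finInd Y) = n * (2 * l (finInd Y)) := by ring
    rw [e, abs_mul, abs_of_pos hn, abs_mul, abs_two] at k1
    have := le_of_mul_le_mul_left k1 hn
    have e2 : 44 * D / κ ^ 2 = 2 * (22 * D / κ ^ 2) := by ring
    linarith
  have k4 : |(∑ x, u x) * l (finInd Y)| ≤ n * (22 * D / κ ^ 2) := by
    rw [abs_mul]
    exact mul_le_mul hsum k3 (abs_nonneg _) hn.le
  have k5 : n * |l u| ≤ n * (66 * D / κ ^ 2) := by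
    have e3 : n * (66 * D / κ ^ 2) = n * (44 * D / κ ^ 2) + n * (22 * D / κ ^ 2) := by ring
    rw [e3, ← abs_of_pos hn, ← abs_mul, abs_of_pos hn]
    have : n * l u = (l u * n + (∑ x, u x) * l (finInd Y)) - (∑ x, u x) * l (finInd Y) := by ring
    rw [this]
    exact (abs_sub _ _).trans (add_le_add k2 k4)
  exact le_of_mul_le_mul_left k5 hn

end Rounding

section Trilinear

variable {V : Type} [Fintype V]

/-- The trilinear form with kernel `f`. -/
def triSum (f : V → V → V → ℝ) (u v w : V → ℝ) : ℝ := ∑ x, ∑ y, ∑ z, f x y z * u x * v y * w z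

/-- The trilinear form as a bilinear map in its first two arguments. -/
def triBilin (f : V → V → V → ℝ) (w : V → ℝ) : (V → ℝ) →ₗ[ℝ] (V → ℝ) →ₗ[ℝ] ℝ :=
  LinearMap.mk₂ ℝ (fun u v => triSum f u v w)
    (fun u u' v => by simp [triSum, mul_add, add_mul, sum_add_distrib])
    (fun c u v => by
      simp only [triSum, Pi.smul_apply, smul_eq_mul, mul_sum]
      exact sum_congr rfl fun x _ => sum_congr rfl fun y _ => sum_congr rfl fun z _ => by ring)
    (fun u v v' => by simp [triSum, mul_add, add_mul, sum_add_distrib])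
    (fun c u v => by
      simp only [triSum, Pi.smul_apply, smul_eq_mul, mul_sum]
      exact sum_congr rfl fun x _ => sum_congr rfl fun y _ => sum_congr rfl fun z _ => by ring)

/-- The trilinear form as a linear map in its last argument. -/
def triLin (f : V → V → V → ℝ) (u v : V → ℝ) : (V → ℝ) →ₗ[ℝ] ℝ where
  toFun w := triSum f u v w
  map_add' w w' := by simp [triSum, mul_add, sum_add_distrib]
  map_smul' c w := by
    simp only [triSum, Pi.smul_apply, smul_eq_mul, mul_sum, RingHom.id_apply]
    exact sum_congr rfl fun x _ => sum_congr rfl fun y _ => sum_congr rfl fun z _ => by ring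

@[simp] lemma triBilin_apply (f : V → V → V → ℝ) (u v w : V → ℝ) :
    triBilin f w u v = triSum f u v w := rfl

@[simp] lemma triLin_apply (f : V → V → V → ℝ) (u v w : V → ℝ) :
    triLin f u v w = triSum f u v w := rfl

/-- Full symmetry of a ternary kernel. -/
structure IsSymm₃ {V : Type} (f : V → V → V → ℝ) : Prop where
  swap_left : ∀ x y z, f x y z = f y x z
  swap_right : ∀ x y z, f x y z = f x z y

variable {f : V → V → V → ℝ}

lemma IsSymm₃.triSum_swap_left (hf : IsSymm₃ f) (u v w : V → ℝ) :
    triSum f u v w = triSum f v u w := by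
  unfold triSum
  rw [sum_comm]
  exact sum_congr rfl fun x _ => sum_congr rfl fun y _ => sum_congr rfl fun z _ => by
    rw [hf.swap_left]; ring

lemma IsSymm₃.triSum_swap_right (hf : IsSymm₃ f) (u v w : V → ℝ) :
    triSum f u v w = triSum f u w v := by
  unfold triSum
  refine sum_congr rfl fun x _ => ?_
  rw [sum_comm]
  exact sum_congr rfl fun y _ => sum_congr rfl fun z _ => by rw [hf.swap_right]; ring

lemma abs_triSum_le (hf1 : ∀ x y z, |f x y z| ≤ 1) (u v w : V → ℝ) :
    |triSum f u v w| ≤ (∑ x, |u x|) * (∑ x, |v x|) * ∑ x, |w x| := by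
  have e : (∑ x, |u x|) * (∑ x, |v x|) * ∑ x, |w x| = ∑ x, ∑ y, ∑ z, |u x| * |v y| * |w z| := by
    rw [sum_mul_sum, sum_mul]
    refine sum_congr rfl fun x _ => ?_
    rw [sum_mul_sum]
  rw [e]
  refine (abs_sum_le_sum_abs _ _).trans (sum_le_sum fun x _ => ?_)
  refine (abs_sum_le_sum_abs _ _).trans (sum_le_sum fun y _ => ?_)
  refine (abs_sum_le_sum_abs _ _).trans (sum_le_sum fun z _ => ?_)
  rw [abs_mul, abs_mul, abs_mul]
  gcongr
  exact mul_le_of_le_one_left (abs_nonneg _) (hf1 x y z)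

lemma sum_abs_le_card {u : V → ℝ} (hu : ∀ x, |u x| ≤ 1) {Q : Finset V} (hQ : ∀ x ∉ Q, u x = 0) :
    ∑ x, |u x| ≤ Q.card := by
  have : ∑ x, |u x| = ∑ x ∈ Q, |u x| :=
    (sum_subset (subset_univ _) fun x _ hx => by simp [hQ x hx]).symm
  rw [this]
  exact (sum_le_sum fun x _ => hu x).trans (by simp)

lemma sum_abs_single_sub_single_le [DecidableEq V] (x y : V) :
    ∑ z, |(Pi.single x 1 - Pi.single y 1 : V → ℝ) z| ≤ 2 := by
  calc ∑ z, |(Pi.single x 1 - Pi.single y 1 : V → ℝ) z|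
      ≤ ∑ z, (|(Pi.single x 1 : V → ℝ) z| + |(Pi.single y 1 : V → ℝ) z|) :=
        sum_le_sum fun z _ => abs_sub _ _
    _ = ∑ z, ((Pi.single x 1 : V → ℝ) z + (Pi.single y 1 : V → ℝ) z) := by
        refine sum_congr rfl fun z _ => ?_
        simp only [Pi.single_apply]
        split_ifs <;> simp
    _ = 2 := by
        simp only [sum_add_distrib, sum_pi_single', mem_univ, if_true]
        norm_num

lemma IsSymm₃.abs_triSum_le_of_coloring (hf : IsSymm₃ f) (hf1 : ∀ x y z, |f x y z| ≤ 1)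
    {m : ℕ} (c : V → Fin m) {s D : ℝ} (hs : ∀ i, (#{x | c x = i} : ℝ) ≤ s)
    (h : ∀ i, ∀ u v w : V → ℝ, (∀ x, |u x| ≤ 1) → (∀ x, |v x| ≤ 1) → (∀ x, |w x| ≤ 1) →
      (∀ x, c x = i → u x = 0) → (∀ x, c x = i → v x = 0) → (∀ x, c x ≠ i → w x = 0) →
      |triSum f u v w| ≤ D)
    {u v w : V → ℝ} (hu : ∀ x, |u x| ≤ 1) (hv : ∀ x, |v x| ≤ 1) (hw : ∀ x, |w x| ≤ 1) :
    |triSum f u v w| ≤ m ^ 3 * D + m * s ^ 3 := by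
  let r : (V → ℝ) → Fin m → V → ℝ := fun u i x => if c x = i then u x else 0
  have r1 : ∀ u : V → ℝ, (∀ x, |u x| ≤ 1) → ∀ i x, |r u i x| ≤ 1 := fun u hu i x => by
    simp only [r]; split_ifs
    · exact hu x
    · simp
  have r0 : ∀ (u : V → ℝ) i x, c x ≠ i → r u i x = 0 := fun u i x hx => if_neg hx
  have rs : ∀ u : V → ℝ, u = ∑ i, r u i := fun u => by
    funext x; simp [r]
  have e : triSum f u v w = ∑ i, ∑ j, ∑ k, triSum f (r u i) (r v j) (r w k) := by
    have e1 : ∀ u v, triSum f u v w = ∑ k, triSum f u v (r w k) := fun u v => by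
      conv_lhs => rw [rs w]
      exact map_sum (triLin f u v) _ _
    have e2 : ∀ u w, triSum f u v w = ∑ j, triSum f u (r v j) w := fun u w => by
      conv_lhs => rw [rs v]
      exact map_sum (triBilin f w u) _ _
    have e3 : ∀ v w, triSum f u v w = ∑ i, triSum f (r u i) v w := fun v w => by
      conv_lhs => rw [rs u]
      rw [← triBilin_apply, map_sum, LinearMap.sum_apply]
      rfl
    rw [e3]
    refine sum_congr rfl fun i _ => ?_
    rw [e2]
    exact sum_congr rfl fun j _ => e1 _ _
  have bound : ∀ i j k, |triSum f (r u i) (r v j) (r w k)| ≤ D + if i = j ∧ i = k then s ^ 3 else 0 := by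
    intro i j k
    have hD : 0 ≤ D := (abs_nonneg _).trans
      (h i 0 0 0 (by simp) (by simp) (by simp) (by simp) (by simp) (by simp))
    by_cases hij : i = j
    · by_cases hik : i = k
      · rw [if_pos ⟨hij, hik⟩]
        subst hij hik
        have hc : ∀ u : V → ℝ, (∀ x, |u x| ≤ 1) → ∑ x, |r u i x| ≤ s := fun u hu =>
          (sum_abs_le_card (Q := {x | c x = i}) (r1 u hu i)
            fun x hx => r0 u i x (by simpa using hx)).trans (hs i)
        have hs0 : 0 ≤ s := (Nat.cast_nonneg _).trans (hs i)
        have h0 : ∀ u : V → ℝ, 0 ≤ ∑ x, |r u i x| := fun u => sum_nonneg fun _ _ => abs_nonneg _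
        have := abs_triSum_le hf1 (r u i) (r v i) (r w i)
        have h2 : (∑ x, |r u i x|) * (∑ x, |r v i x|) * ∑ x, |r w i x| ≤ s * s * s :=
          mul_le_mul (mul_le_mul (hc u hu) (hc v hv) (h0 v) hs0) (hc w hw) (h0 w) (by positivity)
        linarith [show s * s * s = s ^ 3 by ring]
      · rw [if_neg fun h => hik h.2, add_zero]
        exact h k _ _ _ (r1 u hu i) (r1 v hv j) (r1 w hw k)
          (fun x hx => r0 _ _ _ fun hx' => hik (hx'.symm.trans hx))
          (fun x hx => r0 _ _ _ fun hx' => hik (hij.trans (hx'.symm.trans hx))) (r0 w k)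
    · rw [if_neg fun h => hij h.1, add_zero]
      by_cases hjk : j = k
      · rw [hf.triSum_swap_left, hf.triSum_swap_right]
        exact h i _ _ _ (r1 v hv j) (r1 w hw k) (r1 u hu i)
          (fun x hx => r0 _ _ _ fun hx' => hij (hx.symm.trans hx'))
          (fun x hx => r0 _ _ _ fun hx' => hij ((hx.symm.trans hx').trans hjk.symm)) (r0 u i)
      · rw [hf.triSum_swap_right]
        exact h j _ _ _ (r1 u hu i) (r1 w hw k) (r1 v hv j)
          (fun x hx => r0 _ _ _ fun hx' => hij (hx'.symm.trans hx))
          (fun x hx => r0 _ _ _ fun hx' => hjk (hx.symm.trans hx')) (r0 v j)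
  rw [e]
  refine (abs_sum_le_sum_abs _ _).trans ?_
  calc ∑ i, |∑ j, ∑ k, triSum f (r u i) (r v j) (r w k)|
      ≤ ∑ i : Fin m, ∑ j : Fin m, ∑ k : Fin m, (D + if i = j ∧ i = k then s ^ 3 else 0) :=
        sum_le_sum fun i _ => (abs_sum_le_sum_abs _ _).trans (sum_le_sum fun j _ =>
          (abs_sum_le_sum_abs _ _).trans (sum_le_sum fun k _ => bound i j k))
    _ = m ^ 3 * D + m * s ^ 3 := by
        simp [sum_add_distrib, ite_and]
        ring

variable [DecidableEq V] [Nonempty V] {a b : ℕ} {D κ : ℝ}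

lemma abs_triSum_finInd_finInd_le (hκ : 0 < κ) (hκb : κ * Fintype.card V ≤ b)
    (hab : a + b + κ * Fintype.card V ≤ Fintype.card V)
    (h : ∀ U B : Finset V, Disjoint U B → U.card = a → B.card = b →
      |triSum f (finInd U) (finInd U) (finInd B)| ≤ D)
    {U : Finset V} (hU : U.card = a) {w : V → ℝ} (hw : ∀ x, |w x| ≤ 1) (hwU : ∀ x ∈ U, w x = 0) :
    |triSum f (finInd U) (finInd U) w| ≤ 66 * D / κ ^ 2 := by
  have hN : (0 : ℝ) < Fintype.card V := by exact_mod_cast Fintype.card_pos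
  have hc : ((Uᶜ.card : ℕ) : ℝ) = Fintype.card V - a := by
    rw [card_compl, hU, Nat.cast_sub (hU ▸ card_le_univ U)]
  have hκN := mul_pos hκ hN
  have hle : κ * (Uᶜ.card : ℝ) ≤ κ * Fintype.card V := by
    gcongr; exact card_le_univ _
  refine abs_linear_le (triLin f (finInd U) (finInd U)) (Y := Uᶜ) (k := b) ?_ hκ
    (hle.trans hκb) (by rw [hc] at hle ⊢; linarith) (fun B hB hBb => ?_) hw
    fun x hx => hwU x (by simpa using hx)
  · rw [← card_pos, ← Nat.cast_pos (α := ℝ), hc]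
    have : (0 : ℝ) ≤ b := Nat.cast_nonneg b
    linarith
  · exact h U B (disjoint_left.2 fun x hx hxB => by simpa [hx] using hB hxB) hU hBb

lemma IsSymm₃.abs_triSum_le_of_disjoint_supports (hf : IsSymm₃ f) (hf1 : ∀ x y z, |f x y z| ≤ 1)
    (hκ : 0 < κ) (hκa : κ * Fintype.card V ≤ a) {Q : Finset V}
    (haQ : a + Q.card + κ * Fintype.card V ≤ Fintype.card V)
    (h : ∀ U : Finset V, U.card = a → ∀ w : V → ℝ, (∀ x, |w x| ≤ 1) → (∀ x ∈ U, w x = 0) →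
      |triSum f (finInd U) (finInd U) w| ≤ D)
    {u v w : V → ℝ} (hu : ∀ x, |u x| ≤ 1) (hv : ∀ x, |v x| ≤ 1) (hw : ∀ x, |w x| ≤ 1)
    (huQ : ∀ x ∈ Q, u x = 0) (hvQ : ∀ x ∈ Q, v x = 0) (hwQ : ∀ x ∉ Q, w x = 0) :
    |triSum f u v w| ≤ 22 * (D + 4 * Fintype.card V * Fintype.card V) / κ ^ 2 := by
  have hN : (0 : ℝ) < Fintype.card V := by exact_mod_cast Fintype.card_pos
  have hc : ((Qᶜ.card : ℕ) : ℝ) = Fintype.card V - Q.card := by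
    rw [card_compl, Nat.cast_sub (card_le_univ Q)]
  have hκN := mul_pos hκ hN
  have hle : κ * (Qᶜ.card : ℝ) ≤ κ * Fintype.card V := by
    gcongr; exact card_le_univ _
  refine abs_bilinear_le (triBilin f w) (Y := Qᶜ) (k := a)
    (fun u v => hf.triSum_swap_left u v w) (fun x y => ?_) (by positivity) ?_ hκ
    (hle.trans hκa) (by rw [hc] at hle ⊢; linarith) (fun U hU hUa => ?_) hu hv
    (fun x hx => huQ x (by simpa using hx)) fun x hx => hvQ x (by simpa using hx)
  · refine (abs_triSum_le hf1 _ _ _).trans ?_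
    have h1 := sum_abs_single_sub_single_le x y
    have h2 : ∑ x, |w x| ≤ Fintype.card V := by
      simpa using sum_abs_le_card hw (Q := univ) (by simp)
    have h3 : (∑ z, |(Pi.single x 1 - Pi.single y 1 : V → ℝ) z|)
        * ∑ z, |(Pi.single x 1 - Pi.single y 1 : V → ℝ) z| ≤ 2 * 2 :=
      mul_le_mul h1 h1 (sum_nonneg fun _ _ => abs_nonneg _) zero_le_two
    exact mul_le_mul (by linarith) h2 (sum_nonneg fun _ _ => abs_nonneg _) (by norm_num)
  · rw [← card_pos, ← Nat.cast_pos (α := ℝ), hc]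
    have : (0 : ℝ) ≤ a := Nat.cast_nonneg a
    linarith
  · exact h U hUa w hw fun x hx => hwQ x (by simpa using hU hx)

end Trilinear

lemma card_fin_mod_eq_le {N m : ℕ} (i : ℕ) :
    #{x : Fin N | (x : ℕ) % m = i} ≤ N / m + 1 := by
  rw [← card_range (N / m + 1)]
  refine card_le_card_of_injOn (fun x => (x : ℕ) / m) (fun x _ => ?_) fun x hx y hy hxy => ?_
  · simp only [coe_range, Set.mem_Iio]
    exact Nat.lt_succ_of_le (Nat.div_le_div_right x.2.le)
  · simp only [coe_filter, mem_univ, true_and, Set.mem_ofPred_eq] at hx hy hxy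
    ext
    rw [← Nat.div_add_mod (x : ℕ) m, ← Nat.div_add_mod (y : ℕ) m, hx, hy, hxy]

lemma triSum_eq_expect {V : Type} [Fintype V] [Nonempty V] (f : V → V → V → ℝ) (u v w : V → ℝ) :
    𝔼 x, 𝔼 y, 𝔼 z, f x y z * u x * v y * w z = triSum f u v w / (Fintype.card V : ℝ) ^ 3 := by
  have : (Fintype.card V : ℝ) ≠ 0 := by exact_mod_cast Fintype.card_ne_zero
  simp only [Fintype.expect_eq_sum_div_card, ← sum_div]
  unfold triSum
  field_simp

/-- A bounded symmetric ternary kernel that is small on all products of indicators `U × U × B` with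
`U` and `B` disjoint of prescribed proportions is small on all products of bounded functions. -/
lemma exists_weakSmall₃ {α β ε : ℝ} (hα : 0 < α) (hβ : 0 < β) (hαβ : α + β < 1) (hε : 0 < ε) :
    ∃ δ > 0, ∃ N₀ : ℕ, ∀ N ≥ N₀, ∀ f : Fin N → Fin N → Fin N → ℝ, IsSymm₃ f →
      (∀ x y z, |f x y z| ≤ 1) →
      (∀ U B : Finset (Fin N), Disjoint U B → U.card = ⌊α * (N : ℝ)⌋₊ → B.card = ⌊β * (N : ℝ)⌋₊ →
        |triSum f (finInd U) (finInd U) (finInd B)| ≤ δ * N ^ 3) →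
      WeakSmall₃ ε f := by
  obtain ⟨κ, hκ, hκα, hκβ, hκ1, hκ2⟩ : ∃ κ > 0, κ ≤ α / 2 ∧ κ ≤ β / 2 ∧ κ ≤ 1 - α - β ∧
      κ ≤ (1 - α) / 2 := by
    refine ⟨min (min (α / 2) (β / 2)) (min (1 - α - β) ((1 - α) / 2)), ?_, ?_, ?_, ?_, ?_⟩
    · refine lt_min (lt_min (by linarith) (by linarith)) (lt_min (by linarith) (by linarith))
    · exact (min_le_left _ _).trans (min_le_left _ _)
    · exact (min_le_left _ _).trans (min_le_right _ _)
    · exact (min_le_right _ _).trans (min_le_left _ _)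
    · exact (min_le_right _ _).trans (min_le_right _ _)
  obtain ⟨m, hm0, hm1, hm2⟩ : ∃ m : ℕ, 0 < m ∧ 2 / (m : ℝ) ≤ (1 - α) / 2 ∧
      8 / (m : ℝ) ^ 2 ≤ ε / 2 := by
    have h1 := (tendsto_const_div_atTop_nhds_zero_nat (2 : ℝ)).eventually
      (ge_mem_nhds (show (0 : ℝ) < (1 - α) / 2 by linarith))
    have h2 := ((tendsto_const_nhds (x := (8 : ℝ))).div_atTop ((tendsto_pow_atTop two_ne_zero).comp
      (tendsto_natCast_atTop_atTop (R := ℝ)))).eventually (ge_mem_nhds (half_pos hε))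
    obtain ⟨m, h⟩ := ((eventually_gt_atTop 0).and (h1.and h2)).exists
    exact ⟨m, h.1, h.2.1, h.2.2⟩
  have hmR : (0 : ℝ) < m := by exact_mod_cast hm0
  obtain ⟨N₀, hN₀⟩ := exists_nat_ge (max (max (2 / α) (2 / β)) (352 * m ^ 3 / (κ ^ 2 * ε)))
  refine ⟨ε * κ ^ 4 / (4 * 22 * 66 * m ^ 3), by positivity, max N₀ m, fun N hN f hf hf1 h => ?_⟩
  set δ := ε * κ ^ 4 / (4 * 22 * 66 * m ^ 3) with hδ
  have hNm : m ≤ N := (le_max_right _ _).trans hN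
  have hNmR : (m : ℝ) ≤ N := by exact_mod_cast hNm
  have hN0 : (0 : ℝ) < N := hmR.trans_le hNmR
  have : NeZero N := ⟨by rintro rfl; simp at hN0⟩
  have hNN : max (max (2 / α) (2 / β)) (352 * m ^ 3 / (κ ^ 2 * ε)) ≤ (N : ℝ) :=
    hN₀.trans (by exact_mod_cast (le_max_left _ _).trans hN)
  have hNα : 2 / α ≤ N := (le_max_left _ _).trans ((le_max_left _ _).trans hNN)
  have hNβ : 2 / β ≤ N := (le_max_right _ _).trans ((le_max_left _ _).trans hNN)
  have hNε : 352 * m ^ 3 / (κ ^ 2 * ε) ≤ N := (le_max_right _ _).trans hNN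
  rw [div_le_iff₀ hα] at hNα
  rw [div_le_iff₀ hβ] at hNβ
  rw [div_le_iff₀ (by positivity)] at hNε
  have hαN := Nat.lt_floor_add_one (α * (N : ℝ))
  have hβN := Nat.lt_floor_add_one (β * (N : ℝ))
  have hαN' : (⌊α * (N : ℝ)⌋₊ : ℝ) ≤ α * N := Nat.floor_le (by positivity)
  have hβN' : (⌊β * (N : ℝ)⌋₊ : ℝ) ≤ β * N := Nat.floor_le (by positivity)
  set a := ⌊α * (N : ℝ)⌋₊
  set b := ⌊β * (N : ℝ)⌋₊
  have hκa : κ * (Fintype.card (Fin N) : ℝ) ≤ a := by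
    rw [Fintype.card_fin]
    have := mul_le_mul_of_nonneg_right hκα hN0.le
    linarith
  have hκb : κ * (Fintype.card (Fin N) : ℝ) ≤ b := by
    rw [Fintype.card_fin]
    have := mul_le_mul_of_nonneg_right hκβ hN0.le
    linarith
  have hab : a + b + κ * (Fintype.card (Fin N) : ℝ) ≤ Fintype.card (Fin N) := by
    rw [Fintype.card_fin]
    have := mul_le_mul_of_nonneg_right hκ1 hN0.le
    linarith
  have hs : ∀ i : Fin m, (#{x : Fin N | (⟨(x : ℕ) % m, Nat.mod_lt _ hm0⟩ : Fin m) = i} : ℝ)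
      ≤ 2 / m * N := by
    intro i
    have h1 : #{x : Fin N | (⟨(x : ℕ) % m, Nat.mod_lt _ hm0⟩ : Fin m) = i} ≤ N / m + 1 := by
      simpa only [Fin.ext_iff] using card_fin_mod_eq_le (N := N) (m := m) (i : ℕ)
    have h2 : ((N / m + 1 : ℕ) : ℝ) ≤ N / m + 1 := by
      push_cast
      gcongr
      exact Nat.cast_div_le
    have h3 : (1 : ℝ) ≤ N / m := by rwa [one_le_div hmR]
    calc (#{x : Fin N | (⟨(x : ℕ) % m, Nat.mod_lt _ hm0⟩ : Fin m) = i} : ℝ)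
        ≤ ((N / m + 1 : ℕ) : ℝ) := by exact_mod_cast h1
      _ ≤ 2 / m * N := by
        have : 2 / (m : ℝ) * N = N / m + N / m := by ring
        linarith
  intro u v w hu hv hw
  rw [triSum_eq_expect, abs_div, abs_of_pos (by simp only [Fintype.card_fin]; positivity :
    (0 : ℝ) < (Fintype.card (Fin N) : ℝ) ^ 3), Fintype.card_fin, div_le_iff₀ (by positivity)]
  have key := hf.abs_triSum_le_of_coloring hf1 (fun x => ⟨(x : ℕ) % m, Nat.mod_lt _ hm0⟩) hs
    (D := 22 * (66 * (δ * N ^ 3) / κ ^ 2 + 4 * Fintype.card (Fin N) * Fintype.card (Fin N)) / κ ^ 2)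
    (fun i u v w hu hv hw hui hvi hwi =>
      hf.abs_triSum_le_of_disjoint_supports hf1 hκ hκa
        (Q := {x : Fin N | (⟨(x : ℕ) % m, Nat.mod_lt _ hm0⟩ : Fin m) = i})
        (by
          rw [Fintype.card_fin]
          have h1 := hs i
          have h2 := mul_le_mul_of_nonneg_right hm1 hN0.le
          have h3 := mul_le_mul_of_nonneg_right hκ2 hN0.le
          linarith)
        (fun U hU w hw hwU => abs_triSum_finInd_finInd_le hκ hκb hab h hU hw hwU) hu hv hw
        (fun x hx => hui x (by simpa using hx)) (fun x hx => hvi x (by simpa using hx))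
        fun x hx => hwi x (by simpa using hx)) hu hv hw
  refine key.trans ?_
  rw [Fintype.card_fin]
  have e1 : (m : ℝ) ^ 3 * (22 * (66 * (δ * N ^ 3) / κ ^ 2 + 4 * N * N) / κ ^ 2)
      = ε / 4 * N ^ 3 + (88 * m ^ 3 / κ ^ 2) * N ^ 2 := by
    rw [hδ]; field_simp; ring
  have e2 : (m : ℝ) * (2 / m * N) ^ 3 = 8 / m ^ 2 * N ^ 3 := by
    field_simp; ring
  have e3 : 88 * (m : ℝ) ^ 3 / κ ^ 2 ≤ ε / 4 * N := by
    rw [div_le_iff₀ (by positivity)]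
    linarith
  have e4 := mul_le_mul_of_nonneg_right e3 (by positivity : (0 : ℝ) ≤ (N : ℝ) ^ 2)
  have e5 := mul_le_mul_of_nonneg_right hm2 (by positivity : (0 : ℝ) ≤ (N : ℝ) ^ 3)
  rw [e1, e2]
  have e6 : ε / 4 * (N : ℝ) * N ^ 2 = ε / 4 * N ^ 3 := by ring
  linarith

section Splitting

variable {ι V : Type} [DecidableEq ι]

/-- `H` is bounded by one and, in the coordinates `i` and `j`, is a product of a function of the
`i`-th and a function of the `j`-th coordinate. -/
def SplitsAt (i j : ι) (H : (ι → V) → ℝ) : Prop :=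
  ∀ φ : ι → V, ∃ u v : V → ℝ, (∀ x, |u x| ≤ 1) ∧ (∀ x, |v x| ≤ 1) ∧
    ∀ x y, H (Function.update (Function.update φ i x) j y) = u x * v y

lemma SplitsAt.mul {i j : ι} {H H' : (ι → V) → ℝ} (h : SplitsAt i j H) (h' : SplitsAt i j H') :
    SplitsAt i j fun φ => H φ * H' φ := by
  intro φ
  obtain ⟨u, v, hu, hv, e⟩ := h φ
  obtain ⟨u', v', hu', hv', e'⟩ := h' φ
  exact ⟨fun x => u x * u' x, fun x => v x * v' x, fun x => abs_mul_le_one (hu x) (hu' x),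
    fun x => abs_mul_le_one (hv x) (hv' x), fun x y => by beta_reduce; rw [e, e']; ring⟩

lemma SplitsAt.prod {i j : ι} {κ : Type} (s : Finset κ) {H : κ → (ι → V) → ℝ}
    (h : ∀ k ∈ s, SplitsAt i j (H k)) : SplitsAt i j fun φ => ∏ k ∈ s, H k φ := by
  classical
  induction s using Finset.induction_on with
  | empty => exact fun φ => ⟨fun _ => 1, fun _ => 1, by simp, by simp, by simp⟩
  | insert k s hk ih =>
    simp only [prod_insert hk]
    exact (h k (mem_insert_self _ _)).mul (ih fun l hl => h l (mem_insert_of_mem hl))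

lemma splitsAt_apply {i j : ι} {u : V → ℝ} (hu : ∀ x, |u x| ≤ 1) (k : ι) :
    SplitsAt i j fun φ : ι → V => u (φ k) := by
  intro φ
  by_cases hk : k = j
  · subst hk
    exact ⟨fun _ => 1, u, by simp, hu, fun x y => by simp⟩
  · exact ⟨fun x => u (Function.update φ i x k), fun _ => 1, fun x => hu _, by simp,
      fun x y => by simp [hk]⟩

lemma IsUnitKernel.splitsAt {A : V → V → ℝ} (hA : IsUnitKernel A) {i j a b : ι}
    (h : (a ≠ j ∧ b ≠ j) ∨ (a ≠ i ∧ b ≠ i)) (hij : i ≠ j) :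
    SplitsAt i j fun φ : ι → V => A (φ a) (φ b) := by
  intro φ
  rcases h with ⟨h1, h2⟩ | ⟨h1, h2⟩
  · exact ⟨fun x => A (Function.update φ i x a) (Function.update φ i x b), fun _ => 1,
      fun x => hA.abs_le_one _ _, by simp, fun x y => by simp [h1, h2]⟩
  · refine ⟨fun _ => 1, fun y => A (Function.update φ j y a) (Function.update φ j y b),
      by simp, fun x => hA.abs_le_one _ _, fun x y => ?_⟩
    rw [Function.update_comm hij]
    simp [h1, h2]

end Splitting

section Counting

variable {ι V : Type} [Fintype ι] [DecidableEq ι] [Fintype V]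

/-- Averaging over all functions can be done by first resampling one coordinate. -/
lemma expect_update [Nonempty V] (i : ι) (h : (ι → V) → ℝ) :
    𝔼 φ, 𝔼 x, h (Function.update φ i x) = 𝔼 φ, h φ := by
  let T : (ι → V) × V → (ι → V) × V := fun q => (Function.update q.1 i q.2, q.1 i)
  have hT : Function.Involutive T := fun q => by simp [T]
  have h1 : 𝔼 φ, 𝔼 x, h (Function.update φ i x) = 𝔼 q : (ι → V) × V, h (T q).1 := by
    rw [← univ_product_univ, expect_product]
  have h2 : 𝔼 q : (ι → V) × V, h (T q).1 = 𝔼 q : (ι → V) × V, h q.1 :=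
    Fintype.expect_equiv hT.toPerm _ _ fun q => rfl
  rw [h1, h2, ← univ_product_univ, expect_product]
  simp

lemma WeakSmall₂.abs_expect_mul_le [Nonempty V] {δ : ℝ} {g : V → V → ℝ} (hg : WeakSmall₂ δ g)
    {i j : ι} (hij : i ≠ j) {H : (ι → V) → ℝ} (hH : SplitsAt i j H) :
    |𝔼 φ : ι → V, g (φ i) (φ j) * H φ| ≤ δ := by
  rw [← expect_update j, ← expect_update i]
  refine abs_expect_le_of_forall fun φ => ?_
  obtain ⟨u, v, hu, hv, e⟩ := hH φ
  refine le_trans (le_of_eq ?_) (hg u v hu hv)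
  congr 1
  refine expect_congr rfl fun x _ => expect_congr rfl fun y _ => ?_
  rw [e]
  simp [hij, mul_assoc]

/-- Counting lemma: a weakly constant kernel has the expected weighted density of every graph. -/
lemma IsUnitKernel.abs_expect_prod_sub_le [LinearOrder ι] [Nonempty V] {A : V → V → ℝ} {p δ : ℝ}
    (hA : IsUnitKernel A) (hp0 : 0 ≤ p) (hp1 : p ≤ 1) (h : WeakSmall₂ δ fun x y => A x y - p)
    {u : ι → V → ℝ} (hu : ∀ i x, |u i x| ≤ 1) (P : Finset (ι × ι)) (hP : ∀ e ∈ P, e.1 < e.2) :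
    |𝔼 φ : ι → V, (∏ e ∈ P, A (φ e.1) (φ e.2) - p ^ P.card) * ∏ i, u i (φ i)| ≤ P.card * δ := by
  induction P using Finset.induction_on with
  | empty => simp
  | insert e P he ih =>
    have hP' := fun e' he' => hP e' (mem_insert_of_mem he')
    have hlt := hP e (mem_insert_self _ _)
    have e1 : 𝔼 φ : ι → V, (∏ e ∈ insert e P, A (φ e.1) (φ e.2) - p ^ (insert e P).card)
          * ∏ i, u i (φ i)
        = (𝔼 φ : ι → V, (A (φ e.1) (φ e.2) - p)
            * ((∏ e ∈ P, A (φ e.1) (φ e.2)) * ∏ i, u i (φ i)))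
          + p * 𝔼 φ : ι → V, (∏ e ∈ P, A (φ e.1) (φ e.2) - p ^ P.card) * ∏ i, u i (φ i) := by
      rw [mul_expect, ← expect_add_distrib]
      refine expect_congr rfl fun φ _ => ?_
      rw [prod_insert he, card_insert_of_notMem he]
      ring
    have h1 : SplitsAt e.1 e.2 fun φ : ι → V =>
        (∏ e ∈ P, A (φ e.1) (φ e.2)) * ∏ i, u i (φ i) := by
      refine (SplitsAt.prod P fun e' he' => ?_).mul (SplitsAt.prod univ fun k _ =>
        splitsAt_apply (hu k) k)
      refine hA.splitsAt ?_ hlt.ne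
      have hlt' := hP' e' he'
      by_contra! hcon
      obtain ⟨c1, c2⟩ := hcon
      refine he (?_ : e ∈ P)
      have : e' = e := by
        by_cases h1 : e'.1 = e.2
        · have h2 : e'.1 ≠ e.1 := fun h => hlt.ne (h.symm.trans h1)
          have h3 := c2 h2
          rw [h1, h3] at hlt'
          exact absurd hlt' hlt.not_gt
        · have h2 := c1 h1
          by_cases h3 : e'.1 = e.1
          · exact Prod.ext h3 h2
          · exact absurd ((c2 h3).symm.trans h2) hlt.ne
      rwa [← this]
    have h2 := h.abs_expect_mul_le hlt.ne h1
    have h3 := ih hP'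
    rw [e1, card_insert_of_notMem he]
    refine (abs_add_le _ _).trans ?_
    rw [abs_mul, abs_of_nonneg hp0]
    push_cast
    have := (mul_le_of_le_one_left (abs_nonneg _) hp1).trans h3
    linarith

end Counting

section GraphCounts

open Classical in
/-- The adjacency kernel of a graph. -/
noncomputable def adjKernel {V : Type} (G : SimpleGraph V) (x y : V) : ℝ :=
  if G.Adj x y then 1 else 0

lemma isUnitKernel_adjKernel {V : Type} (G : SimpleGraph V) : IsUnitKernel (adjKernel G) where
  symm x y := by
    classical
    unfold adjKernel
    exact if_congr (G.adj_comm x y) rfl rfl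
  nonneg x y := by unfold adjKernel; split_ifs <;> simp
  le_one x y := by unfold adjKernel; split_ifs <;> simp

open Classical in
/-- The edges of a graph on `Fin m` as increasing pairs. -/
noncomputable def edgePairs {m : ℕ} (F : SimpleGraph (Fin m)) : Finset (Fin m × Fin m) :=
  univ.filter fun e => e.1 < e.2 ∧ F.Adj e.1 e.2

lemma mem_edgePairs {m : ℕ} {F : SimpleGraph (Fin m)} {e : Fin m × Fin m} :
    e ∈ edgePairs F ↔ e.1 < e.2 ∧ F.Adj e.1 e.2 := by simp [edgePairs]

lemma card_edgePairs {m : ℕ} (F : SimpleGraph (Fin m)) : (edgePairs F).card = numEdges F := by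
  unfold numEdges
  rw [← Nat.card_eq_finsetCard]
  refine Nat.card_eq_of_bijective (fun e : edgePairs F =>
    (⟨s(e.1.1, e.1.2), (mem_edgePairs.1 e.2).2⟩ : F.edgeSet)) ⟨?_, ?_⟩
  · rintro ⟨⟨a, b⟩, hab⟩ ⟨⟨c, d⟩, hcd⟩ h
    have h1 := (mem_edgePairs.1 hab).1
    have h2 := (mem_edgePairs.1 hcd).1
    replace h : s(a, b) = s(c, d) := congrArg Subtype.val h
    rw [Sym2.eq_iff] at h
    rcases h with ⟨rfl, rfl⟩ | ⟨rfl, rfl⟩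
    · rfl
    · exact absurd h1 h2.not_gt
  · rintro ⟨e, he⟩
    induction e with
    | _ a b =>
      have hab : F.Adj a b := he
      rcases lt_trichotomy a b with hlt | heq | hlt
      · exact ⟨⟨(a, b), mem_edgePairs.2 ⟨hlt, hab⟩⟩, rfl⟩
      · exact absurd heq hab.ne
      · exact ⟨⟨(b, a), mem_edgePairs.2 ⟨hlt, hab.symm⟩⟩, Subtype.ext Sym2.eq_swap⟩

lemma prod_adjKernel_mem {m : ℕ} {V : Type} (F : SimpleGraph (Fin m)) (G : SimpleGraph V) (φ : Fin m → V) :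
    0 ≤ ∏ e ∈ edgePairs F, adjKernel G (φ e.1) (φ e.2) ∧
      ∏ e ∈ edgePairs F, adjKernel G (φ e.1) (φ e.2) ≤ 1 :=
  ⟨prod_nonneg fun _ _ => (isUnitKernel_adjKernel G).nonneg _ _,
    prod_le_one (fun _ _ => (isUnitKernel_adjKernel G).nonneg _ _)
      fun _ _ => (isUnitKernel_adjKernel G).le_one _ _⟩

lemma totalCount_eq_labCount {m : ℕ} {V : Type} [Fintype V] (F : SimpleGraph (Fin m)) (G : SimpleGraph V) :
    totalCount F G = labCount F G fun _ => univ := by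
  unfold totalCount labCount
  simp

variable {m : ℕ} {V : Type} [Fintype V] [DecidableEq V]

lemma labCount_eq_sum (F : SimpleGraph (Fin m)) (G : SimpleGraph V) (U : Fin m → Finset V) :
    (labCount F G U : ℝ) = ∑ φ : Fin m → V with Function.Injective φ,
      (∏ e ∈ edgePairs F, adjKernel G (φ e.1) (φ e.2)) * ∏ i, finInd (U i) (φ i) := by
  classical
  unfold labCount adjKernel finInd
  simp only [prod_ite_zero, prod_const_one]
  rw [Nat.card_eq_fintype_card, Fintype.card_subtype, card_filter, Nat.cast_sum, sum_filter]
  refine sum_congr rfl fun φ _ => ?_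
  have e : (∀ i j, F.Adj i j → G.Adj (φ i) (φ j)) ↔ ∀ e ∈ edgePairs F, G.Adj (φ e.1) (φ e.2) := by
    refine ⟨fun h e he => h _ _ (mem_edgePairs.1 he).2, fun h i j hij => ?_⟩
    rcases lt_trichotomy i j with hlt | heq | hlt
    · exact h (i, j) (mem_edgePairs.2 ⟨hlt, hij⟩)
    · exact absurd heq hij.ne
    · exact (h (j, i) (mem_edgePairs.2 ⟨hlt, hij.symm⟩)).symm
  simp only [e]
  by_cases h1 : Function.Injective φ
  · by_cases h3 : ∀ i, φ i ∈ U i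
    · by_cases h2 : ∀ e ∈ edgePairs F, G.Adj (φ e.1) (φ e.2) <;> simp [h1, h2, h3]
    · simp [h1, h3]
  · simp [h1]

lemma card_filter_injective :
    #{φ : Fin m → V | Function.Injective φ} = (Fintype.card V).descFactorial m := by
  classical
  rw [← Fintype.card_subtype, Fintype.card_congr (Equiv.subtypeInjectiveEquivEmbedding (Fin m) V),
    Fintype.card_embedding_eq, Fintype.card_fin]

lemma abs_sum_sub_sum_injective_le {h : (Fin m → V) → ℝ} (hh : ∀ φ, |h φ| ≤ 1) :
    |∑ φ : Fin m → V with Function.Injective φ, h φ - ∑ φ, h φ|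
      ≤ (Fintype.card V : ℝ) ^ m - (Fintype.card V).descFactorial m := by
  classical
  rw [← sum_filter_add_sum_filter_not univ (fun φ : Fin m → V => Function.Injective φ) h,
    sub_add_cancel_left, abs_neg]
  refine (abs_sum_le_sum_abs _ _).trans ((sum_le_sum fun φ _ => hh φ).trans (le_of_eq ?_))
  have := card_filter_add_card_filter_not (s := (univ : Finset (Fin m → V)))
    (fun φ : Fin m → V => Function.Injective φ)
  rw [card_filter_injective, card_univ, Fintype.card_fun, Fintype.card_fin] at this
  rw [sum_const, nsmul_one, eq_sub_iff_add_eq, ← Nat.cast_pow, ← this, Nat.cast_add, add_comm]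

lemma abs_labCount_sub_sum_le (F : SimpleGraph (Fin m)) (G : SimpleGraph V)
    (U : Fin m → Finset V) :
    |(labCount F G U : ℝ) - ∑ φ : Fin m → V,
      (∏ e ∈ edgePairs F, adjKernel G (φ e.1) (φ e.2)) * ∏ i, finInd (U i) (φ i)|
      ≤ (Fintype.card V : ℝ) ^ m - (Fintype.card V).descFactorial m := by
  rw [labCount_eq_sum]
  refine abs_sum_sub_sum_injective_le fun φ => abs_mul_le_one ?_ ?_
  · have := prod_adjKernel_mem F G φ
    rw [abs_of_nonneg this.1]
    exact this.2
  · rw [abs_prod]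
    exact prod_le_one (fun _ _ => abs_nonneg _) fun i _ => abs_finInd_le_one _ _

/-- Counting lemma for labelled embeddings into prescribed sets. -/
lemma abs_labCount_sub_le [Nonempty V] {p δ : ℝ} (hp0 : 0 ≤ p) (hp1 : p ≤ 1)
    (F : SimpleGraph (Fin m)) (G : SimpleGraph V)
    (h : WeakSmall₂ δ fun x y => adjKernel G x y - p) (U : Fin m → Finset V) :
    |(labCount F G U : ℝ) - p ^ numEdges F * ∏ i, ((U i).card : ℝ)|
      ≤ numEdges F * δ * (Fintype.card V : ℝ) ^ m
        + ((Fintype.card V : ℝ) ^ m - (Fintype.card V).descFactorial m) := by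
  have h1 := abs_labCount_sub_sum_le F G U
  have h2 := (isUnitKernel_adjKernel G).abs_expect_prod_sub_le hp0 hp1 h
    (u := fun i => finInd (U i)) (fun i => abs_finInd_le_one _) (edgePairs F)
    fun e he => (mem_edgePairs.1 he).1
  have hn : (0 : ℝ) < (Fintype.card V : ℝ) ^ m :=
    pow_pos (by exact_mod_cast Fintype.card_pos) m
  rw [card_edgePairs, Fintype.expect_eq_sum_div_card, Fintype.card_fun, Fintype.card_fin,
    Nat.cast_pow, abs_div, abs_of_pos hn, div_le_iff₀ hn] at h2
  have h3 : ∑ φ : Fin m → V, ∏ i, finInd (U i) (φ i) = ∏ i, ((U i).card : ℝ) := by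
    rw [← Fintype.piFinset_univ, ← prod_univ_sum]
    simp only [sum_finInd]
  simp only [sub_mul, sum_sub_distrib, ← mul_sum, h3] at h2
  calc _ = |((labCount F G U : ℝ) - ∑ φ : Fin m → V,
          (∏ e ∈ edgePairs F, adjKernel G (φ e.1) (φ e.2)) * ∏ i, finInd (U i) (φ i))
        + ((∑ φ : Fin m → V,
          (∏ e ∈ edgePairs F, adjKernel G (φ e.1) (φ e.2)) * ∏ i, finInd (U i) (φ i))
          - p ^ numEdges F * ∏ i, ((U i).card : ℝ))| := by congr 1; ring
    _ ≤ _ := (abs_add_le _ _).trans (by linarith)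

lemma tendsto_pow_sub_descFactorial_div (m : ℕ) :
    Tendsto (fun N : ℕ => ((N : ℝ) ^ m - N.descFactorial m) / (N : ℝ) ^ m) atTop (nhds 0) := by
  have h1 := (isEquivalent_descFactorial m).isLittleO.tendsto_div_nhds_zero
  have h2 := h1.neg
  rw [neg_zero] at h2
  refine h2.congr fun N => ?_
  simp only [Pi.sub_apply]
  ring

end GraphCounts

section SymKernel

/-- The symmetrised weighted count of embeddings of `F` at the tuple `ψ`, minus its expected
value. -/
noncomputable def symKernel {m : ℕ} {V : Type} (F : SimpleGraph (Fin m)) (A : V → V → ℝ) (p : ℝ)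
    (ψ : Fin m → V) : ℝ :=
  (m.factorial : ℝ)⁻¹ * ∑ σ : Equiv.Perm (Fin m), ∏ e ∈ edgePairs F, A (ψ (σ e.1)) (ψ (σ e.2))
    - p ^ numEdges F

variable {m : ℕ} {V : Type}

lemma symKernel_comp_perm (F : SimpleGraph (Fin m)) (A : V → V → ℝ) (p : ℝ) (ψ : Fin m → V)
    (τ : Equiv.Perm (Fin m)) : symKernel F A p (ψ ∘ τ) = symKernel F A p ψ := by
  unfold symKernel
  congr 2
  exact Fintype.sum_equiv (Equiv.mulLeft τ) _ _ fun σ => by simp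

lemma abs_symKernel_le_one (F : SimpleGraph (Fin m)) {A : V → V → ℝ} (hA : IsUnitKernel A)
    {p : ℝ} (hp0 : 0 ≤ p) (hp1 : p ≤ 1) (ψ : Fin m → V) : |symKernel F A p ψ| ≤ 1 := by
  have hm : (0 : ℝ) < m.factorial := by exact_mod_cast m.factorial_pos
  have h0 : ∀ σ : Equiv.Perm (Fin m), 0 ≤ ∏ e ∈ edgePairs F, A (ψ (σ e.1)) (ψ (σ e.2)) :=
    fun σ => prod_nonneg fun _ _ => hA.nonneg _ _
  have h1 : ∀ σ : Equiv.Perm (Fin m), ∏ e ∈ edgePairs F, A (ψ (σ e.1)) (ψ (σ e.2)) ≤ 1 :=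
    fun σ => prod_le_one (fun _ _ => hA.nonneg _ _) fun _ _ => hA.le_one _ _
  have h2 := sum_nonneg fun σ (_ : σ ∈ univ) => h0 σ
  have h3 := sum_le_sum fun σ (_ : σ ∈ univ) => h1 σ
  rw [sum_const, nsmul_one, card_univ, Fintype.card_perm, Fintype.card_fin] at h3
  have h4 := mul_nonneg (inv_nonneg.2 hm.le) h2
  have h5 := mul_le_mul_of_nonneg_left h3 (inv_nonneg.2 hm.le)
  rw [inv_mul_cancel₀ hm.ne'] at h5
  have h6 := pow_nonneg hp0 (numEdges F)
  have h7 := pow_le_one₀ hp0 hp1 (n := numEdges F)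
  unfold symKernel
  rw [abs_le]
  constructor <;> linarith

/-- The symmetrised count is the total of the symmetrised kernel, up to non-injective tuples. -/
lemma abs_symCount_sub_sum_le [Fintype V] [DecidableEq V] (F : SimpleGraph (Fin m))
    (G : SimpleGraph V) (p : ℝ) (U : Fin m → Finset V) :
    |symCount F G U - p ^ numEdges F * ∏ i, ((U i).card : ℝ)
      - ∑ ψ : Fin m → V, symKernel F (adjKernel G) p ψ * ∏ i, finInd (U i) (ψ i)|
      ≤ (Fintype.card V : ℝ) ^ m - (Fintype.card V).descFactorial m := by
  have hm : (0 : ℝ) < m.factorial := by exact_mod_cast m.factorial_pos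
  have h3 : ∑ φ : Fin m → V, ∏ i, finInd (U i) (φ i) = ∏ i, ((U i).card : ℝ) := by
    rw [← Fintype.piFinset_univ, ← prod_univ_sum]
    simp only [sum_finInd]
  have key : ∀ σ : Equiv.Perm (Fin m), |(labCount F G (fun i => U (σ i)) : ℝ)
      - ∑ ψ : Fin m → V, (∏ e ∈ edgePairs F, adjKernel G (ψ (σ e.1)) (ψ (σ e.2)))
        * ∏ i, finInd (U i) (ψ i)|
      ≤ (Fintype.card V : ℝ) ^ m - (Fintype.card V).descFactorial m := by
    intro σ
    refine le_trans (le_of_eq ?_) (abs_labCount_sub_sum_le F G fun i => U (σ i))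
    congr 2
    refine Fintype.sum_equiv (σ.symm.arrowCongr (Equiv.refl V)) _ _ fun ψ => ?_
    simp only [Equiv.arrowCongr_apply, Equiv.symm_symm, Equiv.coe_refl, Function.comp_apply, id]
    congr 1
    exact (Equiv.prod_comp σ fun i => finInd (U i) (ψ i)).symm
  have e1 : symCount F G U - p ^ numEdges F * ∏ i, ((U i).card : ℝ)
      - ∑ ψ : Fin m → V, symKernel F (adjKernel G) p ψ * ∏ i, finInd (U i) (ψ i)
      = (m.factorial : ℝ)⁻¹ * ∑ σ : Equiv.Perm (Fin m), ((labCount F G (fun i => U (σ i)) : ℝ)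
      - ∑ ψ : Fin m → V, (∏ e ∈ edgePairs F, adjKernel G (ψ (σ e.1)) (ψ (σ e.2)))
        * ∏ i, finInd (U i) (ψ i)) := by
    unfold symCount symKernel
    simp only [sub_mul, sum_sub_distrib, ← mul_sum, h3, mul_assoc, sum_mul, mul_sub]
    rw [sum_comm]
    ring
  rw [e1, abs_mul, abs_of_pos (inv_pos.2 hm), inv_mul_le_iff₀ hm]
  refine (abs_sum_le_sum_abs _ _).trans ((sum_le_sum fun σ _ => key σ).trans (le_of_eq ?_))
  rw [sum_const, card_univ, Fintype.card_perm, Fintype.card_fin, nsmul_eq_mul]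

lemma sum_fin_succ_fun [Fintype V] (h : (Fin (m + 1) → V) → ℝ) :
    ∑ φ, h φ = ∑ x, ∑ φ : Fin m → V, h (Matrix.vecCons x φ) := by
  rw [← Fintype.sum_prod_type' (f := fun x (φ : Fin m → V) => h (Matrix.vecCons x φ))]
  exact (Fintype.sum_equiv (Fin.consEquiv fun _ => V) _ _ fun q => rfl).symm

lemma sum_fin_zero_fun [Fintype V] (h : (Fin 0 → V) → ℝ) : ∑ φ, h φ = h ![] := by
  rw [Fintype.sum_unique]
  congr 1

lemma isSymm₃_symKernel (F : SimpleGraph (Fin 3)) (A : V → V → ℝ) (p : ℝ) :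
    IsSymm₃ fun x y z => symKernel F A p ![x, y, z] where
  swap_left x y z := by
    rw [← symKernel_comp_perm F A p ![y, x, z] (Equiv.swap 0 1)]
    congr 1
    ext i
    fin_cases i <;> rfl
  swap_right x y z := by
    rw [← symKernel_comp_perm F A p ![x, z, y] (Equiv.swap 1 2)]
    congr 1
    ext i
    fin_cases i <;> rfl

lemma abs_symCount_sub_triSum_le [Fintype V] [DecidableEq V] (F : SimpleGraph (Fin 3))
    (G : SimpleGraph V) (p : ℝ) (U B : Finset V) :
    |symCount F G ![U, U, B] - p ^ numEdges F * ((U.card : ℝ) ^ 2 * (B.card : ℝ))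
      - triSum (fun x y z => symKernel F (adjKernel G) p ![x, y, z])
        (finInd U) (finInd U) (finInd B)|
      ≤ (Fintype.card V : ℝ) ^ 3 - (Fintype.card V).descFactorial 3 := by
  refine le_trans (le_of_eq ?_) (abs_symCount_sub_sum_le F G p ![U, U, B])
  simp only [sum_fin_succ_fun, sum_fin_zero_fun, Fin.prod_univ_three, triSum, Matrix.cons_val]
  congr 2
  · ring
  · simp only [mul_assoc]

lemma prod_edgePairs_fin_three (F : SimpleGraph (Fin 3)) [DecidableRel F.Adj] {M : Type}
    [CommMonoid M] (h : Fin 3 × Fin 3 → M) :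
    ∏ e ∈ edgePairs F, h e = (if F.Adj 0 1 then h (0, 1) else 1) *
      (if F.Adj 0 2 then h (0, 2) else 1) * (if F.Adj 1 2 then h (1, 2) else 1) := by
  unfold edgePairs
  rw [prod_filter, Fintype.prod_prod_type]
  simp [Fin.prod_univ_three]

lemma numEdges_fin_three (F : SimpleGraph (Fin 3)) [DecidableRel F.Adj] :
    numEdges F = (if F.Adj 0 1 then 1 else 0) + (if F.Adj 0 2 then 1 else 0)
      + (if F.Adj 1 2 then 1 else 0) := by
  rw [← card_edgePairs, edgePairs, card_filter, Fintype.sum_prod_type]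
  simp [Fin.sum_univ_three]

lemma sum_perm_fin_three (h : Equiv.Perm (Fin 3) → ℝ) :
    ∑ σ, h σ = h 1 + h (Equiv.swap 0 1) + h (Equiv.swap 0 2) + h (Equiv.swap 1 2)
      + h (Equiv.swap 0 1 * Equiv.swap 1 2) + h (Equiv.swap 1 2 * Equiv.swap 0 1) := by
  have e : (univ : Finset (Equiv.Perm (Fin 3))) = {1, Equiv.swap 0 1, Equiv.swap 0 2,
      Equiv.swap 1 2, Equiv.swap 0 1 * Equiv.swap 1 2, Equiv.swap 1 2 * Equiv.swap 0 1} := by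
    decide
  rw [e]
  repeat rw [sum_insert (by decide)]
  rw [sum_singleton]
  ring

/-- Up to isomorphism the graphs on three vertices with an edge are the edge, the cherry and the
triangle. -/
lemma symKernel_fin_three (F : SimpleGraph (Fin 3)) (hF : 0 < numEdges F) {A : V → V → ℝ}
    (hA : IsUnitKernel A) (p : ℝ) :
    ((fun x y z => symKernel F A p ![x, y, z]) = fun x y z => (A x y + A y z + A x z) / 3 - p) ∨
    ((fun x y z => symKernel F A p ![x, y, z]) = fun x y z =>
      (A x y * A y z + A y z * A x z + A x y * A x z) / 3 - p ^ 2) ∨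
    (fun x y z => symKernel F A p ![x, y, z]) = fun x y z => A x y * A y z * A x z - p ^ 3 := by
  classical
  have e (x y z : V) : symKernel F A p ![x, y, z] = _ := rfl
  conv at e => enter [x, y, z]; rhs; unfold symKernel; rw [sum_perm_fin_three]
  simp only [prod_edgePairs_fin_three, numEdges_fin_three] at e
  rw [numEdges_fin_three] at hF
  by_cases h1 : F.Adj 0 1 <;> by_cases h2 : F.Adj 0 2 <;> by_cases h3 : F.Adj 1 2 <;>
    simp [h1, h2, h3, Equiv.swap_apply_def, Nat.factorial] at e hF
  all_goals
    simp only [funext_iff, e]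
    first
      | (left; intro x y z; rw [hA.symm y x, hA.symm z x, hA.symm z y]; ring1)
      | (right; left; intro x y z; rw [hA.symm y x, hA.symm z x, hA.symm z y]; ring1)
      | (right; right; intro x y z; rw [hA.symm y x, hA.symm z x, hA.symm z y]; ring1)

lemma WeakSmall₃.mono [Fintype V] {δ δ' : ℝ} {f : V → V → V → ℝ} (h : WeakSmall₃ δ f)
    (hδ : δ ≤ δ') : WeakSmall₃ δ' f :=
  fun u v w hu hv hw => (h u v w hu hv hw).trans hδ

/-- If the symmetrised density of `F` is weakly constant, then the kernel is weakly constant. -/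
lemma exists_weakSmall₂_of_symKernel (F : SimpleGraph (Fin 3)) (hF : 0 < numEdges F) {p : ℝ}
    (hp0 : 0 < p) (hp1 : p ≤ 1) {ε : ℝ} (hε : 0 < ε) :
    ∃ δ > 0, ∀ (V : Type) [Fintype V] [Nonempty V] (A : V → V → ℝ), IsUnitKernel A →
      (WeakSmall₃ δ fun x y z => symKernel F A p ![x, y, z]) →
      WeakSmall₂ ε fun x y => A x y - p := by
  obtain ⟨δ₂, hδ₂, h₂⟩ := exists_weakSmall₂_of_cherry hp0 hp1 hε
  obtain ⟨δ₃, hδ₃, h₃⟩ := exists_weakSmall₂_of_triangle hp0 hp1 hε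
  refine ⟨min (ε / 7) (min δ₂ δ₃), lt_min (by positivity) (lt_min hδ₂ hδ₃),
    fun V _ _ A hA h => ?_⟩
  rcases symKernel_fin_three F hF hA p with e | e | e <;> rw [e] at h
  · have := weakSmall₂_of_edge (h.mono (min_le_left _ _))
    rwa [mul_div_cancel₀ ε (by norm_num : (7 : ℝ) ≠ 0)] at this
  · exact h₂ V A hA (h.mono ((min_le_right _ _).trans (min_le_left _ _)))
  · exact h₃ V A hA (h.mono ((min_le_right _ _).trans (min_le_right _ _)))

lemma eventually_pow_sub_descFactorial_le (m : ℕ) {δ : ℝ} (hδ : 0 < δ) :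
    ∃ N₀ : ℕ, ∀ N ≥ N₀, (N : ℝ) ^ m - N.descFactorial m ≤ δ * (N : ℝ) ^ m := by
  obtain ⟨N₀, h⟩ := eventually_atTop.1
    ((tendsto_pow_sub_descFactorial_div m).eventually (gt_mem_nhds hδ))
  refine ⟨max N₀ 1, fun N hN => ?_⟩
  have hN1 : (0 : ℝ) < (N : ℝ) ^ m := pow_pos (by exact_mod_cast (le_max_right _ _).trans hN) m
  exact (div_le_iff₀ hN1).1 (h N ((le_max_left _ _).trans hN)).le

/-- A large graph in which the symmetrised counts of `F` in pairs of disjoint sets of given sizes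
are close to the expected ones has a weakly constant adjacency kernel. -/
lemma exists_weakSmall₂_adjKernel (F : SimpleGraph (Fin 3)) (hF : 0 < numEdges F)
    {α β : ℝ} (hα : 0 < α) (hβ : 0 < β) (hαβ : α + β < 1) {p : ℝ} (hp0 : 0 < p) (hp1 : p ≤ 1)
    {ε : ℝ} (hε : 0 < ε) :
    ∃ δ > 0, ∃ N₀ : ℕ, ∀ N ≥ N₀, ∀ G : SimpleGraph (Fin N),
      (∀ U B : Finset (Fin N), Disjoint U B → U.card = ⌊α * (N : ℝ)⌋₊ →
        B.card = ⌊β * (N : ℝ)⌋₊ →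
        |symCount F G ![U, U, B] - p ^ numEdges F * ((U.card : ℝ) ^ 2 * (B.card : ℝ))|
          ≤ δ * (N : ℝ) ^ 3) →
      WeakSmall₂ ε fun x y => adjKernel G x y - p := by
  obtain ⟨δ₁, hδ₁, h₁⟩ := exists_weakSmall₂_of_symKernel F hF hp0 hp1 hε
  obtain ⟨δ₂, hδ₂, N₂, h₂⟩ := exists_weakSmall₃ hα hβ hαβ hδ₁
  obtain ⟨N₃, h₃⟩ := eventually_pow_sub_descFactorial_le 3 (half_pos hδ₂)
  refine ⟨δ₂ / 2, half_pos hδ₂, max (max N₂ N₃) 1, fun N hN G h => ?_⟩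
  simp only [ge_iff_le, max_le_iff] at hN
  have : NeZero N := ⟨by omega⟩
  have hG := isUnitKernel_adjKernel G
  refine h₁ _ _ hG (h₂ N hN.1.1 _ (isSymm₃_symKernel F _ p)
    (fun x y z => abs_symKernel_le_one F hG hp0.le hp1 _) fun U B hd hU hB => ?_)
  have k1 := h U B hd hU hB
  have k2 := abs_symCount_sub_triSum_le F G p U B
  have k3 := h₃ N hN.1.2
  rw [Fintype.card_fin] at k2
  have k4 := abs_sub_abs_le_abs_sub
    (triSum (fun x y z => symKernel F (adjKernel G) p ![x, y, z]) (finInd U) (finInd U) (finInd B))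
    (symCount F G ![U, U, B] - p ^ numEdges F * ((U.card : ℝ) ^ 2 * (B.card : ℝ)))
  rw [abs_sub_comm (triSum _ _ _ _)] at k4
  linarith

end SymKernel

section CycleFour

variable {V : Type} [Fintype V] [Nonempty V] {A : V → V → ℝ} {p : ℝ}

/-- A kernel whose degrees and codegrees are almost constant is weakly constant. -/
lemma IsUnitKernel.weakSmall₂_of_ncodeg (hA : IsUnitKernel A) (hp0 : 0 ≤ p) (hp1 : p ≤ 1)
    {μ τ : ℝ} (hμ : 𝔼 x, 𝔼 y, |ncodeg A x y - p ^ 2| ≤ μ) (hτ : 𝔼 x, |ndeg A x - p| ≤ τ) :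
    WeakSmall₂ (√(μ + 2 * τ)) fun x y => A x y - p := by
  intro u v hu hv
  set f : V → ℝ := fun x => 𝔼 y, (A x y - p) * v y with hf
  have e1 : 𝔼 x, f x ^ 2 = 𝔼 y, 𝔼 z,
      (ncodeg A y z - p * ndeg A y - p * ndeg A z + p ^ 2) * v y * v z := by
    have (x : V) : f x ^ 2 = 𝔼 y, 𝔼 z, (A y x - p) * (A z x - p) * v y * v z := by
      rw [sq, hf, expect_mul_expect]
      exact expect_congr rfl fun y _ => expect_congr rfl fun z _ => by
        rw [hA.symm x y, hA.symm x z]; ring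
    simp only [this]
    refine Eq.trans (expect_comm _ _ _) (expect_congr rfl fun y _ => ?_)
    refine Eq.trans (expect_comm _ _ _) (expect_congr rfl fun z _ => ?_)
    simp only [← expect_mul]
    congr 2
    have (x : V) : (A y x - p) * (A z x - p) = A y x * A z x - p * A y x - p * A z x + p ^ 2 := by
      ring
    simp only [this, expect_add_distrib, expect_sub_distrib, ← mul_expect, Fintype.expect_const]
    rfl
  have e2 : 𝔼 x, f x ^ 2 ≤ μ + 2 * τ := by
    rw [e1]
    calc _ ≤ 𝔼 y, 𝔼 z, (|ncodeg A y z - p ^ 2| + |ndeg A y - p| + |ndeg A z - p|) := by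
          refine expect_mono fun y => expect_mono fun z => (le_abs_self _).trans ?_
          rw [mul_assoc, abs_mul]
          refine (mul_le_of_le_one_right (abs_nonneg _) (abs_mul_le_one (hv y) (hv z))).trans ?_
          rw [show ncodeg A y z - p * ndeg A y - p * ndeg A z + p ^ 2
            = (ncodeg A y z - p ^ 2) + -(p * (ndeg A y - p)) + -(p * (ndeg A z - p)) by ring]
          refine (abs_add_three _ _ _).trans ?_
          rw [abs_neg, abs_neg, abs_mul, abs_mul, abs_of_nonneg hp0]
          gcongr <;> exact mul_le_of_le_one_left (abs_nonneg _) hp1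
      _ ≤ μ + 2 * τ := by
          simp only [expect_add_distrib, Fintype.expect_const]
          linarith
  have e3 : 𝔼 x, 𝔼 y, (A x y - p) * u x * v y = 𝔼 x, u x * f x := by
    refine expect_congr rfl fun x _ => ?_
    rw [hf, mul_expect]
    exact expect_congr rfl fun y _ => by ring
  rw [e3]
  refine (abs_expect_le _ _).trans (le_trans (expect_mono fun x => ?_) (expect_le_sqrt e2))
  rw [abs_mul]
  exact mul_le_of_le_one_left (abs_nonneg _) (hu x)

/-- A kernel with the expected densities of edges, cherries and four-cycles is weakly constant. -/
lemma IsUnitKernel.weakSmall₂_of_densities (hA : IsUnitKernel A) (hp0 : 0 ≤ p) (hp1 : p ≤ 1)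
    {η : ℝ} (h1 : |(𝔼 x, 𝔼 y, A x y) - p| ≤ η) (h2 : |(𝔼 x, 𝔼 y, 𝔼 z, A x y * A x z) - p ^ 2| ≤ η)
    (h4 : |(𝔼 x, 𝔼 y, 𝔼 z, 𝔼 w, A x z * A y z * (A x w * A y w)) - p ^ 4| ≤ η) :
    WeakSmall₂ (√(3 * √(3 * η))) fun x y => A x y - p := by
  have c2 : 𝔼 x, 𝔼 y, 𝔼 z, A x y * A x z = 𝔼 x, ndeg A x ^ 2 :=
    expect_congr rfl fun x _ => by rw [sq, ndeg, expect_mul_expect]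
  have c2' : 𝔼 x, 𝔼 y, ncodeg A x y = 𝔼 x, ndeg A x ^ 2 := by
    simp only [expect_ncodeg hA]
    rw [expect_comm]
    refine expect_congr rfl fun y _ => ?_
    rw [← expect_mul, sq]
    congr 1
    exact expect_congr rfl fun x _ => hA.symm _ _
  have c4 : 𝔼 x, 𝔼 y, 𝔼 z, 𝔼 w, A x z * A y z * (A x w * A y w) = 𝔼 x, 𝔼 y, ncodeg A x y ^ 2 :=
    expect_congr rfl fun x _ => expect_congr rfl fun y _ => by rw [sq, ncodeg, expect_mul_expect]
  rw [c2] at h2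
  rw [c4] at h4
  have c1 : 𝔼 x, 𝔼 y, A x y = 𝔼 x, ndeg A x := rfl
  rw [c1] at h1
  have hη : 0 ≤ η := (abs_nonneg _).trans h1
  have hp2 : p ^ 2 ≤ 1 := pow_le_one₀ hp0 hp1
  rw [abs_le] at h1 h2 h4
  have hτ : 𝔼 x, (ndeg A x - p) ^ 2 ≤ 3 * η := by
    have (x : V) : (ndeg A x - p) ^ 2 = ndeg A x ^ 2 - 2 * p * ndeg A x + p ^ 2 := by ring
    simp only [this, expect_add_distrib, expect_sub_distrib, ← mul_expect, Fintype.expect_const]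
    nlinarith [mul_le_mul_of_nonneg_left h1.1 hp0, mul_le_mul_of_nonneg_right hp1 hη]
  have hμ : 𝔼 x, 𝔼 y, (ncodeg A x y - p ^ 2) ^ 2 ≤ 3 * η := by
    have (x y : V) : (ncodeg A x y - p ^ 2) ^ 2
      = ncodeg A x y ^ 2 - 2 * p ^ 2 * ncodeg A x y + p ^ 4 := by ring
    simp only [this, expect_add_distrib, expect_sub_distrib, ← mul_expect, Fintype.expect_const]
    rw [c2']
    nlinarith [mul_le_mul_of_nonneg_left h2.1 (sq_nonneg p), mul_le_mul_of_nonneg_right hp2 hη]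
  refine (hA.weakSmall₂_of_ncodeg hp0 hp1 (expect₂_le_sqrt hμ) (expect_le_sqrt hτ)).mono ?_
  exact Real.sqrt_le_sqrt (by linarith)

end CycleFour

section QuasiRandom

lemma exists_edgePairs_eq {m : ℕ} (P : Finset (Fin m × Fin m)) (hP : ∀ e ∈ P, e.1 < e.2) :
    ∃ F : SimpleGraph (Fin m), edgePairs F = P := by
  refine ⟨⟨fun a b => (a, b) ∈ P ∨ (b, a) ∈ P, ⟨fun a b => Or.symm⟩, ⟨fun a ha => ?_⟩⟩, ?_⟩
  · exact lt_irrefl a (ha.elim (hP _) (hP _))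
  · ext ⟨a, b⟩
    rw [mem_edgePairs]
    constructor
    · rintro ⟨h1, h2 | h2⟩
      · exact h2
      · exact absurd h1 (hP _ h2).not_gt
    · exact fun h => ⟨hP _ h, Or.inl h⟩

lemma expect_fin_succ_fun {V : Type} [Fintype V] {m : ℕ} (h : (Fin (m + 1) → V) → ℝ) :
    𝔼 φ, h φ = 𝔼 x, 𝔼 φ : Fin m → V, h (Matrix.vecCons x φ) := by
  rw [← expect_product' univ univ fun x (φ : Fin m → V) => h (Matrix.vecCons x φ),
    univ_product_univ]
  exact (Fintype.expect_equiv (Fin.consEquiv fun _ => V) _ _ fun q => rfl).symm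

lemma expect_fin_zero_fun {V : Type} [Fintype V] (h : (Fin 0 → V) → ℝ) : 𝔼 φ, h φ = h ![] := by
  rw [Fintype.expect_eq_sum_div_card, sum_fin_zero_fun]
  simp

variable {p : ℝ} {V : ℕ → ℕ} {G : ∀ n, SimpleGraph (Fin (V n))}

lemma IsQuasirandom.eventually_expect (h : IsQuasirandom p V G) (hV : Tendsto V atTop atTop)
    {m : ℕ} (P : Finset (Fin m × Fin m)) (hP : ∀ e ∈ P, e.1 < e.2) {η : ℝ} (hη : 0 < η) :
    ∀ᶠ n in atTop, |(𝔼 φ : Fin m → Fin (V n), ∏ e ∈ P, adjKernel (G n) (φ e.1) (φ e.2))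
      - p ^ P.card| ≤ η := by
  obtain ⟨F, rfl⟩ := exists_edgePairs_eq P hP
  obtain ⟨N₀, hN₀⟩ := eventually_pow_sub_descFactorial_le m (half_pos hη)
  filter_upwards [isLittleO_iff.1 (h m F) (half_pos hη), hV.eventually_ge_atTop (max N₀ 1)]
    with n h1 h2
  have hn : (0 : ℝ) < (V n : ℝ) ^ m :=
    pow_pos (by exact_mod_cast (le_max_right _ _).trans h2) m
  have h3 := hN₀ _ ((le_max_left _ _).trans h2)
  have h4 := abs_labCount_sub_sum_le F (G n) fun _ => univ
  rw [totalCount_eq_labCount, Real.norm_eq_abs, Real.norm_eq_abs, abs_of_pos hn] at h1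
  simp only [finInd, mem_univ, if_true, prod_const_one, mul_one, Fintype.card_fin] at h4
  rw [Fintype.expect_eq_sum_div_card, Fintype.card_fun, Fintype.card_fin, Fintype.card_fin,
    Nat.cast_pow, div_sub' hn.ne', abs_div, abs_of_pos hn, div_le_iff₀ hn, card_edgePairs,
    mul_comm _ (p ^ _)]
  have h5 := abs_sub_le (∑ φ : Fin m → Fin (V n), ∏ e ∈ edgePairs F,
    adjKernel (G n) (φ e.1) (φ e.2)) (labCount F (G n) fun _ => univ)
    (p ^ numEdges F * (V n : ℝ) ^ m)
  rw [abs_sub_comm _ (labCount F (G n) _ : ℝ)] at h5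
  linarith

lemma IsQuasirandom.eventually_weakSmall₂ (h : IsQuasirandom p V G) (hV : Tendsto V atTop atTop)
    (hp0 : 0 ≤ p) (hp1 : p ≤ 1) {ε : ℝ} (hε : 0 < ε) :
    ∀ᶠ n in atTop, WeakSmall₂ ε fun x y => adjKernel (G n) x y - p := by
  set η := (ε ^ 2 / 3) ^ 2 / 3 with hη
  have hη0 : 0 < η := by positivity
  have e : √(3 * √(3 * η)) = ε := by
    rw [hη, mul_div_cancel₀ _ (by norm_num : (3 : ℝ) ≠ 0), Real.sqrt_sq (by positivity),
      mul_div_cancel₀ _ (by norm_num : (3 : ℝ) ≠ 0), Real.sqrt_sq hε.le]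
  filter_upwards [hV.eventually_ge_atTop 1,
    h.eventually_expect hV (m := 2) {(0, 1)} (by decide) hη0,
    h.eventually_expect hV (m := 3) {(0, 1), (0, 2)} (by decide) hη0,
    h.eventually_expect hV (m := 4) {(0, 2), (1, 2), (0, 3), (1, 3)} (by decide) hη0]
    with n h0 h1 h2 h4
  have : NeZero (V n) := ⟨by omega⟩
  rw [← e]
  refine (isUnitKernel_adjKernel (G n)).weakSmall₂_of_densities hp0 hp1 ?_ ?_ ?_
  · simpa [expect_fin_succ_fun, expect_fin_zero_fun] using h1
  · simpa [expect_fin_succ_fun, expect_fin_zero_fun, mul_assoc] using h2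
  · simpa [expect_fin_succ_fun, expect_fin_zero_fun, mul_assoc] using h4

/-- Quasi-randomness is weak convergence of the adjacency kernels to a constant. -/
lemma isQuasirandom_iff_eventually_weakSmall₂ (hV : Tendsto V atTop atTop) (hp0 : 0 ≤ p)
    (hp1 : p ≤ 1) : IsQuasirandom p V G ↔
      ∀ ε > 0, ∀ᶠ n in atTop, WeakSmall₂ ε fun x y => adjKernel (G n) x y - p := by
  refine ⟨fun h ε hε => h.eventually_weakSmall₂ hV hp0 hp1 hε, fun h m F => ?_⟩
  refine isLittleO_iff.2 fun c hc => ?_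
  have hc' : 0 < c / 2 / (numEdges F + 1) := by positivity
  obtain ⟨N₀, hN₀⟩ := eventually_pow_sub_descFactorial_le m (half_pos hc)
  filter_upwards [h _ hc', hV.eventually_ge_atTop (max N₀ 1)] with n h1 h2
  have : NeZero (V n) := ⟨by have := (le_max_right _ _).trans h2; omega⟩
  have h3 := hN₀ _ ((le_max_left _ _).trans h2)
  have h4 := abs_labCount_sub_le hp0 hp1 F (G n) h1 fun _ => univ
  have hn : (0 : ℝ) ≤ (V n : ℝ) ^ m := by positivity
  have h5 : numEdges F * (c / 2 / (numEdges F + 1)) ≤ c / 2 := by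
    rw [mul_div_assoc', div_le_iff₀ (by positivity)]
    nlinarith
  have h6 := mul_le_mul_of_nonneg_right h5 hn
  simp only [card_univ, Fintype.card_fin, prod_const] at h4
  rw [totalCount_eq_labCount, Real.norm_eq_abs, Real.norm_eq_abs, abs_of_nonneg hn]
  linarith

end QuasiRandom

section Main

lemma abs_symCount_sub_le {m : ℕ} {V : Type} [Fintype V] [DecidableEq V] [Nonempty V] {p δ : ℝ}
    (hp0 : 0 ≤ p) (hp1 : p ≤ 1) (F : SimpleGraph (Fin m)) (G : SimpleGraph V)
    (h : WeakSmall₂ δ fun x y => adjKernel G x y - p) (U : Fin m → Finset V) :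
    |symCount F G U - p ^ numEdges F * ∏ i, ((U i).card : ℝ)|
      ≤ numEdges F * δ * (Fintype.card V : ℝ) ^ m
        + ((Fintype.card V : ℝ) ^ m - (Fintype.card V).descFactorial m) := by
  have hm : (0 : ℝ) < m.factorial := by exact_mod_cast m.factorial_pos
  have hc : ((univ : Finset (Equiv.Perm (Fin m))).card : ℝ) = m.factorial := by
    rw [card_univ, Fintype.card_perm, Fintype.card_fin]
  have e : symCount F G U - p ^ numEdges F * ∏ i, ((U i).card : ℝ)
      = (m.factorial : ℝ)⁻¹ * ∑ σ : Equiv.Perm (Fin m), ((labCount F G (fun i => U (σ i)) : ℝ)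
        - p ^ numEdges F * ∏ i, ((U (σ i)).card : ℝ)) := by
    have (σ : Equiv.Perm (Fin m)) : ∏ i, ((U (σ i)).card : ℝ) = ∏ i, ((U i).card : ℝ) :=
      Equiv.prod_comp σ fun i => ((U i).card : ℝ)
    simp only [this, sum_sub_distrib, sum_const, nsmul_eq_mul, hc]
    rw [mul_sub, inv_mul_cancel_left₀ hm.ne', symCount]
  rw [e, abs_mul, abs_of_pos (inv_pos.2 hm), inv_mul_le_iff₀ hm]
  refine (abs_sum_le_sum_abs _ _).trans ((sum_le_sum fun σ _ =>
    abs_labCount_sub_le hp0 hp1 F G h fun i => U (σ i)).trans (le_of_eq ?_))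
  rw [sum_const, nsmul_eq_mul, hc]

/-- A bound that holds eventually, uniformly over finite families, for every constant can be
witnessed by a null sequence. -/
lemma exists_tendsto_zero_of_eventually {ι : ℕ → Type} [∀ n, Finite (ι n)] {D : ∀ n, ι n → ℝ}
    {s : ℕ → ℝ} (hD : ∀ n i, 0 ≤ D n i) (hs : ∀ n, 0 ≤ s n) (h0 : ∀ n i, s n = 0 → D n i = 0)
    (h : ∀ c > 0, ∀ᶠ n in atTop, ∀ i, D n i ≤ c * s n) :
    ∃ ε : ℕ → ℝ, Tendsto ε atTop (nhds 0) ∧ ∀ n i, D n i ≤ ε n * s n := by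
  refine ⟨fun n => ⨆ i, D n i / s n, ?_, fun n i => ?_⟩
  · rw [Metric.tendsto_nhds]
    intro c hc
    filter_upwards [h (c / 2) (half_pos hc)] with n hn
    rw [dist_zero_right, Real.norm_of_nonneg (Real.iSup_nonneg fun i => div_nonneg (hD n i) (hs n))]
    refine (Real.iSup_le (fun i => div_le_of_le_mul₀ (hs n) (half_pos hc).le (hn i))
      (half_pos hc).le).trans_lt (half_lt_self hc)
  · rcases (hs n).eq_or_lt with h1 | h1
    · rw [h0 n i h1.symm, ← h1, mul_zero]
    · rw [← div_le_iff₀ h1]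
      exact le_ciSup (f := fun i => D n i / s n) (Set.finite_range _).bddAbove i

end Main

/-- **Theorem (Tab).** Let `|F| = 3`, `e(F) > 0`, `α, β > 0` with `α + β < 1`,
`0 < p ≤ 1`. The property `P̃₂(F;α,β)`:
`Ñ(F,G_n;U,U,B) = p^(e F) |U|² |B| + o(|G_n|³)` uniformly over disjoint `U, B` with
`|U| = ⌊α|G_n|⌋`, `|B| = ⌊β|G_n|⌋`, is a `p`-quasi-random property. -/
theorem stmt4 (F : SimpleGraph (Fin 3)) (hF : 0 < numEdges F)
    (α β : ℝ) (hα : 0 < α) (hβ : 0 < β) (hαβ : α + β < 1)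
    (p : ℝ) (hp0 : 0 < p) (hp1 : p ≤ 1) :
    ∀ (V : ℕ → ℕ) (G : ∀ n, SimpleGraph (Fin (V n))), Tendsto V atTop atTop →
      ((∃ ε : ℕ → ℝ, Tendsto ε atTop (nhds 0) ∧
          ∀ (n : ℕ) (U B : Finset (Fin (V n))), Disjoint U B →
            U.card = ⌊α * (V n : ℝ)⌋₊ → B.card = ⌊β * (V n : ℝ)⌋₊ →
            |symCount F (G n) ![U, U, B]
                - p ^ numEdges F * ((U.card : ℝ) ^ 2 * (B.card : ℝ))|
              ≤ ε n * (V n : ℝ) ^ 3)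
        ↔ IsQuasirandom p V G) := by
  intro V G hV
  rw [isQuasirandom_iff_eventually_weakSmall₂ hV hp0.le hp1]
  constructor
  · rintro ⟨ε, hε, h⟩ η hη
    obtain ⟨δ, hδ, N₀, hN⟩ := exists_weakSmall₂_adjKernel F hF hα hβ hαβ hp0 hp1 hη
    filter_upwards [hε.eventually (gt_mem_nhds hδ), hV.eventually_ge_atTop N₀] with n h1 h2
    exact hN _ h2 _ fun U B hd hU hB =>
      (h n U B hd hU hB).trans (mul_le_mul_of_nonneg_right h1.le (by positivity))
  · intro h
    have hprod (n : ℕ) (U B : Finset (Fin (V n))) :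
        (U.card : ℝ) ^ 2 * (B.card : ℝ) = ∏ i, ((![U, U, B] i).card : ℝ) := by
      rw [Fin.prod_univ_three]
      simp [sq]
    have hzero (n : ℕ) (q : Finset (Fin (V n)) × Finset (Fin (V n))) (hn : (V n : ℝ) ^ 3 = 0) :
        |symCount F (G n) ![q.1, q.1, q.2]
          - p ^ numEdges F * ((q.1.card : ℝ) ^ 2 * (q.2.card : ℝ))| = 0 := by
      have hV0 : V n = 0 := by simpa using hn
      have : IsEmpty (Fin (V n)) := by rw [hV0]; infer_instance
      have := abs_symCount_sub_sum_le F (G n) p ![q.1, q.1, q.2]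
      rw [← hprod, univ_eq_empty, sum_empty, Fintype.card_fin, hn, sub_zero] at this
      exact le_antisymm (this.trans (sub_nonpos.2 (Nat.cast_nonneg _))) (abs_nonneg _)
    have hsmall (c : ℝ) (hc : c > 0) : ∀ᶠ n in atTop,
        ∀ q : Finset (Fin (V n)) × Finset (Fin (V n)), |symCount F (G n) ![q.1, q.1, q.2]
          - p ^ numEdges F * ((q.1.card : ℝ) ^ 2 * (q.2.card : ℝ))| ≤ c * (V n : ℝ) ^ 3 := by
      have hc' : 0 < c / 2 / (numEdges F + 1) := by positivity
      obtain ⟨N₀, hN₀⟩ := eventually_pow_sub_descFactorial_le 3 (half_pos hc)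
      filter_upwards [h _ hc', hV.eventually_ge_atTop (max N₀ 1)] with n h1 h2 q
      have : NeZero (V n) := ⟨by have := (le_max_right _ _).trans h2; omega⟩
      have h3 := hN₀ _ ((le_max_left _ _).trans h2)
      have h4 := abs_symCount_sub_le hp0.le hp1 F (G n) h1 ![q.1, q.1, q.2]
      have hn : (0 : ℝ) ≤ (V n : ℝ) ^ 3 := by positivity
      have h5 : numEdges F * (c / 2 / (numEdges F + 1)) ≤ c / 2 := by
        rw [mul_div_assoc', div_le_iff₀ (by positivity)]
        nlinarith
      have h6 := mul_le_mul_of_nonneg_right h5 hn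
      rw [← hprod, Fintype.card_fin] at h4
      linarith
    obtain ⟨ε, hε, hb⟩ := exists_tendsto_zero_of_eventually (fun n q => abs_nonneg _)
      (fun n => by positivity) hzero hsmall
    exact ⟨ε, hε, fun n U B _ _ _ => hb n (U, B)⟩
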